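/- arXiv:1005.3486 — 3 statements merged into one kernel-verified Lean document; each statement's English description precedes it below -/
import Mathlib

section
/- Let C be a binary linear [n,k,d] code having exactly t zero coordinates (positions at which every codeword is 0), and let C' be the [n−t,k,d] code obtained by puncturing C at these coordinates. Then for each of the AWGNC pseudoweight, the BSC pseudoweight, and the max-fractional weight, the pseudocodeword redundancies satisfy ρ(C') ≤ ρ(C) ≤ ρ(C') + t. -/
open Matrix BigOperators Finset

section Defs

variable {J I : Type*} [Fintype J] [Fintype I] [DecidableEq I]

/-- The support of row `j` of a binary matrix `H`. -/
def rowSupp (H : Matrix J I (ZMod 2)) (j : J) : Finset I :=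
  Finset.univ.filter fun i => H j i = 1

/-- The fundamental cone of a binary matrix `H`. -/
def fundCone (H : Matrix J I (ZMod 2)) : Set (I → ℝ) :=
  {x | (∀ i, 0 ≤ x i) ∧
    ∀ j : J, ∀ ℓ ∈ rowSupp H j, x ℓ ≤ ∑ i ∈ (rowSupp H j).erase ℓ, x i}

/-- BEC pseudoweight: size of the support. -/
noncomputable def wBEC (x : I → ℝ) : ℝ := ({i | x i ≠ 0}.ncard : ℝ)

/-- AWGNC pseudoweight. -/
noncomputable def wAWGNC (x : I → ℝ) : ℝ := (∑ i, x i) ^ 2 / ∑ i, x i ^ 2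

/-- Max-fractional weight. -/
noncomputable def wMaxFrac (x : I → ℝ) : ℝ := (∑ i, x i) / sSup (Set.range x)

/-- `H` is a parity-check matrix of the code `C`. -/
def IsParityCheck (H : Matrix J I (ZMod 2)) (C : Submodule (ZMod 2) (I → ZMod 2)) : Prop :=
  ∀ c, c ∈ C ↔ H.mulVec c = 0

/-- Minimum Hamming distance of a code. -/
noncomputable def minDist (C : Submodule (ZMod 2) (I → ZMod 2)) : ℕ :=
  sInf {d | ∃ c ∈ C, c ≠ 0 ∧ hammingNorm c = d}

/-- Minimum pseudoweight of `H` w.r.t. pseudoweight function `w`: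
the infimum of `w` over all nonzero pseudocodewords (`⊤` if there are none). -/
noncomputable def minPW (w : (I → ℝ) → ℝ) (H : Matrix J I (ZMod 2)) : EReal :=
  sInf ((fun x => (w x : EReal)) '' (fundCone H \ {0}))

/-- The chain (connectivity) relation associated with a binary matrix whose rows
have weight 2: `i` and `i'` are related iff they are equal or joined by a chain of rows
whose supports are exactly consecutive pairs. -/
def chainRel (H : Matrix J I (ZMod 2)) (i i' : I) : Prop :=
  i = i' ∨ ∃ ℓ : ℕ, 1 ≤ ℓ ∧ ∃ (c : Fin (ℓ + 1) → I) (r : Fin ℓ → J),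
    c 0 = i ∧ c (Fin.last ℓ) = i' ∧
    ∀ t : Fin ℓ, rowSupp H (r t) = {c t.castSucc, c t.succ}

/-- The 0-1 real matrix associated with a binary matrix. -/
def toRealMatrix (H : Matrix J I (ZMod 2)) : Matrix J I ℝ :=
  Matrix.of fun j i => if H j i = 1 then (1 : ℝ) else 0

/-- The Tanner graph of a binary matrix. -/
def tannerGraph (H : Matrix J I (ZMod 2)) : SimpleGraph (J ⊕ I) :=
  SimpleGraph.fromRel fun u v => ∃ j i, u = Sum.inl j ∧ v = Sum.inr i ∧ H j i = 1

end Defs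

/-- The multiset of (real) eigenvalues, with multiplicity, of a real square matrix:
the real roots of its characteristic polynomial. -/
noncomputable def eigMult {ι : Type*} [Fintype ι] [DecidableEq ι] (A : Matrix ι ι ℝ) :
    Multiset ℝ :=
  A.charpoly.roots

section FinDefs

variable {n : ℕ}

/-- The non-increasing rearrangement of a real vector. -/
noncomputable def sortDesc (x : Fin n → ℝ) : Fin n → ℝ :=
  fun i => x (Tuple.sort (fun j => -x j) i)

/-- `Φ(ξ) = ∫₀^ξ φ`, where `φ(ξ) = x'_i` for `i - 1 < ξ ≤ i` and `x'` is the
non-increasing rearrangement of `x`. -/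
noncomputable def bigPhi (x : Fin n → ℝ) (ξ : ℝ) : ℝ :=
  ∑ i : Fin n, sortDesc x i * min 1 (max 0 (ξ - (i : ℝ)))

/-- BSC pseudoweight: `2 Φ⁻¹(Φ(n)/2)`. -/
noncomputable def wBSC (x : Fin n → ℝ) : ℝ :=
  2 * sInf {ξ : ℝ | bigPhi x (n : ℝ) / 2 ≤ bigPhi x ξ}

/-- The pseudocodeword redundancy of a code `C` w.r.t. the pseudoweight function `w`:
the smallest number of rows of a parity-check matrix `H` of `C` whose minimum
pseudoweight equals the minimum distance of `C` (`⊤` if there is no such matrix). -/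
noncomputable def pcRedundancy (w : (Fin n → ℝ) → ℝ)
    (C : Submodule (ZMod 2) (Fin n → ZMod 2)) : ℕ∞ :=
  sInf {k : ℕ∞ | ∃ (m : ℕ) (H : Matrix (Fin m) (Fin n) (ZMod 2)),
    k = (m : ℕ∞) ∧ IsParityCheck H C ∧ minPW w H = ((minDist C : ℝ) : EReal)}

end FinDefs

/-- The properties of a family of pseudoweights used in the proof. -/
structure GoodW (w : ∀ n : ℕ, (Fin n → ℝ) → ℝ) : Prop where
  ext : ∀ (n m : ℕ) (e : Fin m → Fin n), Function.Injective e → ∀ x : Fin m → ℝ,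
    (∀ i, 0 ≤ x i) → w n (Function.extend e x 0) = w m x
  one_le : ∀ (n : ℕ) (x : Fin n → ℝ), (∀ i, 0 ≤ x i) → x ≠ 0 → 1 ≤ w n x
  ones : ∀ d : ℕ, 0 < d → w d (fun _ => 1) = d

theorem sum_extend_zero {m n : ℕ} {M : Type*} [AddCommMonoid M] (e : Fin m → Fin n)
    (he : Function.Injective e) (x : Fin m → M) (f : Fin n → M → M) (hf : ∀ i, f i 0 = 0) :
    ∑ i, f i (Function.extend e x 0 i) = ∑ i, f (e i) (x i) := by
  symm
  apply Finset.sum_of_injOn e he.injOn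
  · simp
  · intro i _ hi
    rw [Function.extend_apply']
    · simp [hf]
    · simpa using hi
  · intro i _
    rw [he.extend_apply]

theorem extend_nonneg {m n : ℕ} (e : Fin m → Fin n)
    (he : Function.Injective e) (x : Fin m → ℝ) (hx : ∀ i, 0 ≤ x i) (i : Fin n) :
    0 ≤ Function.extend e x 0 i := by
  by_cases h : ∃ k, e k = i
  · obtain ⟨k, rfl⟩ := h
    rw [he.extend_apply]; exact hx k
  · rw [Function.extend_apply' _ _ _ h]; simp

theorem exists_pos_of {n : ℕ} (x : Fin n → ℝ) (hx : ∀ i, 0 ≤ x i) (h : x ≠ 0) :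
    ∃ i, 0 < x i := by
  by_contra hc
  push Not at hc
  exact h (funext fun i => le_antisymm (hc i) (hx i))

theorem goodW_AWGNC : GoodW (fun _ => wAWGNC) where
  ext n m e he x hx := by
    unfold wAWGNC
    rw [sum_extend_zero e he x (fun _ y => y) (by simp),
      sum_extend_zero e he x (fun _ y => y ^ 2) (by simp)]
  one_le n x hx h := by
    obtain ⟨i, hi⟩ := exists_pos_of x hx h
    unfold wAWGNC
    have h1 : 0 < ∑ i, x i ^ 2 :=
      Finset.sum_pos' (fun i _ => sq_nonneg _) ⟨i, Finset.mem_univ _, by positivity⟩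
    rw [le_div_iff₀ h1, one_mul]
    exact Finset.sum_sq_le_sq_sum_of_nonneg (fun i _ => hx i)
  ones d hd := by
    have : (d : ℝ) ≠ 0 := by positivity
    simp [wAWGNC]
    field_simp

theorem goodW_MaxFrac : GoodW (fun _ => wMaxFrac) where
  ext n m e he x hx := by
    unfold wMaxFrac
    rw [sum_extend_zero e he x (fun _ y => y) (by simp)]
    congr 1
    apply le_antisymm
    · apply Real.sSup_le
      · rintro _ ⟨i, rfl⟩
        by_cases h : ∃ k, e k = i
        · obtain ⟨k, rfl⟩ := h
          rw [he.extend_apply]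
          exact le_csSup (Set.finite_range x).bddAbove ⟨k, rfl⟩
        · rw [Function.extend_apply' _ _ _ h]
          exact Real.sSup_nonneg (by rintro _ ⟨i, rfl⟩; exact hx i)
      · exact Real.sSup_nonneg (by rintro _ ⟨i, rfl⟩; exact hx i)
    · apply Real.sSup_le
      · rintro _ ⟨i, rfl⟩
        exact le_csSup (Set.finite_range _).bddAbove ⟨e i, he.extend_apply _ _ _⟩
      · exact Real.sSup_nonneg (by rintro _ ⟨i, rfl⟩; exact extend_nonneg e he x hx i)
  one_le n x hx h := by
    obtain ⟨i, hi⟩ := exists_pos_of x hx h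
    unfold wMaxFrac
    have h1 : 0 < sSup (Set.range x) :=
      lt_of_lt_of_le hi (le_csSup (Set.finite_range x).bddAbove ⟨i, rfl⟩)
    rw [le_div_iff₀ h1, one_mul]
    apply Real.sSup_le
    · rintro _ ⟨i, rfl⟩
      exact Finset.single_le_sum (fun i _ => hx i) (Finset.mem_univ i)
    · exact Finset.sum_nonneg fun i _ => hx i
  ones d hd := by
    have : Nonempty (Fin d) := ⟨⟨0, hd⟩⟩
    simp [wMaxFrac, Set.range_const]

theorem sortDesc_antitone {n : ℕ} (x : Fin n → ℝ) : Antitone (sortDesc x) := by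
  intro i j hij
  have := Tuple.monotone_sort (fun j => - x j) hij
  simpa [sortDesc] using this

theorem sortDesc_eq_of_perm {n : ℕ} (x : Fin n → ℝ) (σ : Equiv.Perm (Fin n))
    (h : Antitone (x ∘ σ)) : sortDesc x = x ∘ σ := by
  have h1 : Monotone ((fun j => - x j) ∘ σ) := by
    intro i j hij
    simpa using h hij
  have h2 := Tuple.unique_monotone (Tuple.monotone_sort (fun j => - x j)) h1
  funext i
  have := congrFun h2 i
  simpa [sortDesc] using this

theorem sortDesc_extend {m n : ℕ} (e : Fin m → Fin n) (he : Function.Injective e)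
    (hmn : m ≤ n) (x : Fin m → ℝ) (hx : ∀ i, 0 ≤ x i) :
    sortDesc (Function.extend e x 0) = Function.extend (Fin.castLE hmn) (sortDesc x) 0 := by
  classical
  have hc : Function.Injective (Fin.castLE hmn) := Fin.castLE_injective hmn
  let f : Fin n → Fin n := fun i =>
    if h : (i : ℕ) < m then e (Tuple.sort (fun j => - x j) ⟨i, h⟩) else i
  obtain ⟨g, hg⟩ := Finset.exists_equiv_extend_of_card_eq (α := Fin n) (β := Fin n)
    (t := Finset.univ) (by simp) (s := Finset.univ.filter fun i : Fin n => (i : ℕ) < m) (f := f)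
    (by simp) (by
      intro i hi j hj hij
      have hi' : (i : ℕ) < m := by simpa using hi
      have hj' : (j : ℕ) < m := by simpa using hj
      simp only [f, hi', hj', dif_pos] at hij
      have := (Tuple.sort (fun j => - x j)).injective (he hij)
      exact Fin.ext (by simpa using this))
  let σ : Equiv.Perm (Fin n) := g.trans (Equiv.subtypeUnivEquiv (by simp))
  have hσ : ∀ i : Fin m, σ (Fin.castLE hmn i) = e (Tuple.sort (fun j => - x j) i) := by
    intro i
    have := hg (Fin.castLE hmn i) (by simp)
    have h2 : σ (Fin.castLE hmn i) = (g (Fin.castLE hmn i) : Fin n) := rfl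
    rw [h2, this]
    simp [f]
  have key : Function.extend e x 0 ∘ σ = Function.extend (Fin.castLE hmn) (sortDesc x) 0 := by
    funext i
    by_cases h : ∃ k, Fin.castLE hmn k = i
    · obtain ⟨k, rfl⟩ := h
      rw [hc.extend_apply, Function.comp_apply, hσ, he.extend_apply]
      rfl
    · rw [Function.extend_apply' _ _ _ h, Function.comp_apply, Function.extend_apply']
      · rfl
      · rintro ⟨k, hk⟩
        apply h
        refine ⟨(Tuple.sort (fun j => - x j)).symm k, σ.injective ?_⟩
        rw [hσ, ← hk]
        simp
  rw [← key]
  apply sortDesc_eq_of_perm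
  rw [key]
  intro i j hij
  by_cases hj : ∃ k, Fin.castLE hmn k = j
  · obtain ⟨k, rfl⟩ := hj
    have hi : (i : ℕ) < m := lt_of_le_of_lt (Fin.le_def.1 hij) (by simp)
    have hi2 : i = Fin.castLE hmn ⟨i, hi⟩ := rfl
    rw [hi2, hc.extend_apply, hc.extend_apply]
    apply sortDesc_antitone
    exact Fin.le_def.2 (Fin.le_def.1 hij)
  · rw [Function.extend_apply' _ _ _ hj]
    exact extend_nonneg _ hc _ (fun i => hx _) i

theorem bigPhi_extend {m n : ℕ} (e : Fin m → Fin n) (he : Function.Injective e)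
    (hmn : m ≤ n) (x : Fin m → ℝ) (hx : ∀ i, 0 ≤ x i) (ξ : ℝ) :
    bigPhi (Function.extend e x 0) ξ = bigPhi x ξ := by
  unfold bigPhi
  rw [sortDesc_extend e he hmn x hx,
    sum_extend_zero _ (Fin.castLE_injective hmn) (sortDesc x)
      (fun i y => y * min 1 (max 0 (ξ - (i : ℝ)))) (by simp)]
  simp

theorem bigPhi_large {m : ℕ} (x : Fin m → ℝ) (ξ : ℝ) (h : (m : ℝ) ≤ ξ) :
    bigPhi x ξ = ∑ i, sortDesc x i := by
  unfold bigPhi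
  apply Finset.sum_congr rfl
  intro i _
  have : ((i : ℕ) : ℝ) + 1 ≤ m := by exact_mod_cast i.2
  rw [min_eq_left, mul_one]
  exact le_trans (by linarith) (le_max_right _ _)

theorem sum_clip (d : ℕ) (ξ : ℝ) :
    ∑ i : Fin d, min 1 (max 0 (ξ - (i : ℝ))) = min (d : ℝ) (max 0 ξ) := by
  induction d with
  | zero => simp
  | succ d ih =>
    rw [Fin.sum_univ_castSucc]
    simp only [Fin.val_castSucc, Fin.val_last, ih]
    have hd : (0 : ℝ) ≤ d := by positivity
    push_cast
    rcases le_total ξ 0 with h | h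
    · rw [max_eq_left h, max_eq_left (by linarith)]
      simp [hd]; linarith
    · rw [max_eq_right h]
      rcases le_total ξ d with h1 | h1
      · rw [max_eq_left (by linarith), min_eq_right h1, min_eq_right (by linarith),
          min_eq_right (by linarith)]
        simp

      · rw [max_eq_right (by linarith), min_eq_left h1]
        rcases le_total ξ (d + 1) with h2 | h2
        · rw [min_eq_right (by linarith), min_eq_right h2]; ring
        · rw [min_eq_left (by linarith), min_eq_left h2]

theorem goodW_BSC : GoodW (fun _ => wBSC) where
  ext n m e he x hx := by
    have hmn : m ≤ n := by simpa using Fintype.card_le_of_injective e he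
    unfold wBSC
    simp only [bigPhi_extend e he hmn x hx]
    rw [bigPhi_large x m le_rfl, bigPhi_large x n (by exact_mod_cast hmn)]
  one_le n x hx h := by
    obtain ⟨i, hi⟩ := exists_pos_of x hx h
    have hs : ∀ i, 0 ≤ sortDesc x i := fun i => hx _
    unfold wBSC
    suffices (1 / 2 : ℝ) ≤ sInf {ξ : ℝ | bigPhi x (n : ℝ) / 2 ≤ bigPhi x ξ} by linarith
    have hsum : 0 ≤ bigPhi x n := by
      rw [bigPhi_large x n le_rfl]; exact Finset.sum_nonneg fun i _ => hs i
    apply le_csInf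
    · exact ⟨n, by simp only [Set.mem_ofPred_eq]; linarith⟩
    · intro ξ hξ
      simp only [Set.mem_ofPred_eq] at hξ
      by_contra hlt
      push Not at hlt
      obtain _ | k := n
      · exact i.elim0
      · have h0 : 0 < sortDesc x 0 := by
          have h3 := sortDesc_antitone x (Fin.zero_le ((Tuple.sort (fun j => - x j)).symm i))
          have h4 : sortDesc x ((Tuple.sort (fun j => - x j)).symm i) = x i := by
            simp [sortDesc]
          linarith
        have h1 : sortDesc x 0 ≤ bigPhi x ((k + 1 : ℕ) : ℝ) := by
          rw [bigPhi_large x _ le_rfl]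
          exact Finset.single_le_sum (fun i _ => hs i) (Finset.mem_univ 0)
        have h2 : bigPhi x ξ = sortDesc x 0 * min 1 (max 0 ξ) := by
          unfold bigPhi
          rw [Finset.sum_eq_single 0]
          · simp
          · intro b _ hb
            have : (1 : ℝ) ≤ ((b : ℕ) : ℝ) := by
              exact_mod_cast Nat.one_le_iff_ne_zero.2 (fun h => hb (Fin.ext h))
            rw [max_eq_left (by linarith)]
            simp
          · simp
        have h5 : min 1 (max 0 ξ) < 1 / 2 :=
          lt_of_le_of_lt (min_le_right _ _) (max_lt (by norm_num) hlt)
        have h6 := mul_lt_mul_of_pos_left h5 h0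
        linarith
  ones d hd := by
    have hd' : (0 : ℝ) < d := by exact_mod_cast hd
    have hb : ∀ ξ, bigPhi (fun _ : Fin d => (1 : ℝ)) ξ = min (d : ℝ) (max 0 ξ) := by
      intro ξ
      rw [← sum_clip]
      simp [bigPhi, sortDesc]
    unfold wBSC
    simp only [hb]
    have : {ξ : ℝ | min (d : ℝ) (max 0 (d : ℝ)) / 2 ≤ min (d : ℝ) (max 0 ξ)}
        = Set.Ici ((d : ℝ) / 2) := by
      ext ξ
      rw [max_eq_right hd'.le, min_self]
      simp only [Set.mem_ofPred_eq, Set.mem_Ici, le_min_iff, le_max_iff]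
      constructor
      · rintro ⟨_, h | h⟩
        · linarith
        · exact h
      · intro h
        exact ⟨by linarith, Or.inr h⟩
    rw [this, csInf_Ici]
    ring

theorem hammingNorm_extend {m n : ℕ} (e : Fin m → Fin n) (he : Function.Injective e)
    (c : Fin m → ZMod 2) : hammingNorm (Function.extend e c 0) = hammingNorm c := by
  classical
  unfold hammingNorm
  rw [← Finset.card_image_of_injective _ he]
  congr 1
  ext i
  simp only [Finset.mem_filter, Finset.mem_univ, true_and, Finset.mem_image]
  by_cases h : ∃ k, e k = i
  · obtain ⟨k, rfl⟩ := h
    rw [he.extend_apply]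
    constructor
    · intro h; exact ⟨k, h, rfl⟩
    · rintro ⟨k', h, hk⟩
      rwa [← he hk]
  · rw [Function.extend_apply' _ _ _ h]
    constructor
    · intro h; simp at h
    · rintro ⟨k', _, hk⟩; exact absurd ⟨k', hk⟩ h

theorem zmod2_ne_zero {a : ZMod 2} (h : a ≠ 0) : a = 1 := by
  revert h; revert a; decide

/-- The indicator of a codeword lies in the fundamental cone. -/
theorem indicator_mem_fundCone {m n : ℕ} (H : Matrix (Fin m) (Fin n) (ZMod 2))
    (c : Fin n → ZMod 2) (hc : H.mulVec c = 0) :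
    (fun i => if c i = 0 then (0 : ℝ) else 1) ∈ fundCone H := by
  have hnn : ∀ i, (0 : ℝ) ≤ if c i = 0 then (0 : ℝ) else 1 := by
    intro i; split_ifs <;> norm_num
  refine ⟨hnn, ?_⟩
  intro j ℓ hℓ
  by_cases h0 : c ℓ = 0
  · simp only [h0, if_true]
    exact Finset.sum_nonneg fun i _ => hnn i
  · have hex : ∃ i ∈ (rowSupp H j).erase ℓ, c i ≠ 0 := by
      by_contra hcon
      push Not at hcon
      have h1 := congrFun hc j
      simp only [Matrix.mulVec, dotProduct, Pi.zero_apply] at h1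
      rw [Finset.sum_eq_single ℓ] at h1
      · have : H j ℓ = 1 := by simpa [rowSupp] using hℓ
        rw [this, one_mul] at h1
        exact h0 h1
      · intro b _ hb
        by_cases hH : H j b = 0
        · simp [hH]
        · rw [hcon b (by simp [rowSupp, hb, zmod2_ne_zero hH]), mul_zero]
      · simp
    obtain ⟨i, hi, hci⟩ := hex
    have := Finset.single_le_sum (f := fun i => if c i = 0 then (0 : ℝ) else 1)
      (fun i _ => hnn i) hi
    simp only [hci, if_false] at this
    simpa [h0] using this

theorem w_indicator {w : ∀ n : ℕ, (Fin n → ℝ) → ℝ} (hw : GoodW w) {n : ℕ}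
    (c : Fin n → ZMod 2) (hc : c ≠ 0) :
    w n (fun i => if c i = 0 then (0 : ℝ) else 1) = hammingNorm c := by
  classical
  let S : Finset (Fin n) := Finset.univ.filter fun i => c i ≠ 0
  have hS : S.card = hammingNorm c := rfl
  let e := S.orderEmbOfFin hS
  have he : Function.Injective e := e.injective
  have hr : ∀ i, (∃ k, e k = i) ↔ c i ≠ 0 := by
    intro i
    have := Finset.range_orderEmbOfFin S hS
    have h2 : i ∈ Set.range e ↔ i ∈ (S : Set (Fin n)) := by rw [this]
    simpa [S] using h2
  have : (fun i => if c i = 0 then (0 : ℝ) else 1)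
      = Function.extend e (fun _ => (1 : ℝ)) 0 := by
    funext i
    by_cases h : ∃ k, e k = i
    · have := (hr i).1 h
      obtain ⟨k, rfl⟩ := h
      rw [he.extend_apply, if_neg this]
    · rw [Function.extend_apply' _ _ _ h, if_pos]
      · rfl
      · by_contra h'; exact h ((hr i).2 h')
  rw [this, hw.ext _ _ e he _ (fun _ => zero_le_one), hw.ones]
  exact hammingNorm_pos_iff.2 hc

theorem eq_extend_of {M : Type*} [Zero M] {n m : ℕ} {Z : Finset (Fin n)} {e : Fin m → Fin n}
    (he : Function.Injective e) (hrange : Set.range e = (↑Z : Set (Fin n))ᶜ) (c : Fin n → M)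
    (hc : ∀ i ∈ Z, c i = 0) : c = Function.extend e (fun k => c (e k)) 0 := by
  funext i
  by_cases h : ∃ k, e k = i
  · obtain ⟨k, rfl⟩ := h
    rw [he.extend_apply]
  · rw [Function.extend_apply' _ _ _ h]
    apply hc
    have : i ∉ Set.range e := h
    rw [hrange] at this
    simpa using this

theorem mem_punctured {n m : ℕ} (C : Submodule (ZMod 2) (Fin n → ZMod 2))
    (Z : Finset (Fin n)) (hZ : ∀ i, i ∈ Z ↔ ∀ c ∈ C, c i = 0)
    (e : Fin m → Fin n) (he : Function.Injective e)
    (hrange : Set.range e = (↑Z : Set (Fin n))ᶜ)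
    (C' : Submodule (ZMod 2) (Fin m → ZMod 2))
    (hC' : C' = C.map (LinearMap.funLeft (ZMod 2) (ZMod 2) e))
    (c : Fin m → ZMod 2) : c ∈ C' ↔ Function.extend e c 0 ∈ C := by
  subst hC'
  rw [Submodule.mem_map]
  constructor
  · rintro ⟨d, hd, rfl⟩
    have := eq_extend_of he hrange d (fun i hi => (hZ i).1 hi d hd)
    change Function.extend e (fun k => d (e k)) 0 ∈ C
    rwa [← this]
  · intro h
    refine ⟨_, h, ?_⟩
    funext k
    simp [LinearMap.funLeft_apply, he.extend_apply]

theorem minDist_punctured {n m : ℕ} (C : Submodule (ZMod 2) (Fin n → ZMod 2))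
    (Z : Finset (Fin n)) (hZ : ∀ i, i ∈ Z ↔ ∀ c ∈ C, c i = 0)
    (e : Fin m → Fin n) (he : Function.Injective e)
    (hrange : Set.range e = (↑Z : Set (Fin n))ᶜ)
    (C' : Submodule (ZMod 2) (Fin m → ZMod 2))
    (hC' : C' = C.map (LinearMap.funLeft (ZMod 2) (ZMod 2) e)) : minDist C' = minDist C := by
  unfold minDist
  congr 1
  ext d
  constructor
  · rintro ⟨c, hc, h0, rfl⟩
    have hn := hammingNorm_extend e he c
    refine ⟨_, (mem_punctured C Z hZ e he hrange C' hC' c).1 hc, ?_, hn⟩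
    rw [← hammingNorm_pos_iff, hn]
    exact hammingNorm_pos_iff.2 h0
  · rintro ⟨c, hc, h0, rfl⟩
    have h1 := eq_extend_of he hrange c (fun i hi => (hZ i).1 hi c hc)
    have hn := hammingNorm_extend e he (fun k => c (e k))
    rw [← h1] at hn
    refine ⟨fun k => c (e k), ?_, ?_, hn.symm⟩
    · rw [mem_punctured C Z hZ e he hrange C' hC', ← h1]; exact hc
    · rw [← hammingNorm_pos_iff, ← hn]
      exact hammingNorm_pos_iff.2 h0

theorem extend_ne_zero {n m : ℕ} {e : Fin m → Fin n}
    (he : Function.Injective e) {x : Fin m → ℝ} (h : x ≠ 0) : Function.extend e x 0 ≠ 0 := by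
  intro h0
  apply h
  funext k
  have := congrFun h0 (e k)
  rwa [he.extend_apply] at this

/-- The row inequality in a uniform form: with zero extension. -/
theorem sum_rowSupp_erase {n m r : ℕ} {e : Fin m → Fin n} (he : Function.Injective e)
    (H : Matrix (Fin r) (Fin n) (ZMod 2)) (s : ℕ) (H' : Matrix (Fin s) (Fin m) (ZMod 2))
    (j : Fin r) (j' : Fin s) (hH : ∀ k, H j (e k) = H' j' k) (x : Fin m → ℝ) (k : Fin m) :
    ∑ i ∈ (rowSupp H j).erase (e k), Function.extend e x 0 i
      = ∑ i ∈ (rowSupp H' j').erase k, x i := by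
  symm
  apply Finset.sum_of_injOn e he.injOn
  · intro i hi
    simp only [Finset.coe_erase, Set.mem_sdiff, Finset.mem_coe, Set.mem_singleton_iff, rowSupp,
      Finset.mem_filter, Finset.mem_univ, true_and] at hi ⊢
    exact ⟨by rw [hH]; exact hi.1, fun h => hi.2 (he h)⟩
  · intro i hi hni
    by_cases h : ∃ l, e l = i
    · obtain ⟨l, rfl⟩ := h
      exfalso
      apply hni
      refine ⟨l, ?_, rfl⟩
      simp only [Finset.coe_erase, Set.mem_sdiff, Finset.mem_coe, Set.mem_singleton_iff, rowSupp,
        Finset.mem_filter, Finset.mem_univ, true_and, Finset.mem_erase] at hi ⊢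
      exact ⟨by rw [← hH]; exact hi.2, fun h => hi.1 (by rw [h])⟩
    · rw [Function.extend_apply' _ _ _ h]; rfl
  · intro i _
    rw [he.extend_apply]

theorem lower_bound {w : ∀ n : ℕ, (Fin n → ℝ) → ℝ} (hw : GoodW w) {n m r : ℕ}
    (C : Submodule (ZMod 2) (Fin n → ZMod 2))
    (Z : Finset (Fin n)) (hZ : ∀ i, i ∈ Z ↔ ∀ c ∈ C, c i = 0)
    (e : Fin m → Fin n) (he : Function.Injective e)
    (hrange : Set.range e = (↑Z : Set (Fin n))ᶜ)
    (C' : Submodule (ZMod 2) (Fin m → ZMod 2))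
    (hC' : C' = C.map (LinearMap.funLeft (ZMod 2) (ZMod 2) e))
    (H : Matrix (Fin r) (Fin n) (ZMod 2)) (hH : IsParityCheck H C)
    (hmin : minPW (w n) H = ((minDist C : ℝ) : EReal)) :
    ∃ H' : Matrix (Fin r) (Fin m) (ZMod 2), IsParityCheck H' C' ∧
      minPW (w m) H' = ((minDist C' : ℝ) : EReal) := by
  let H' : Matrix (Fin r) (Fin m) (ZMod 2) := fun j k => H j (e k)
  have hmul : ∀ c : Fin m → ZMod 2, H.mulVec (Function.extend e c 0) = H'.mulVec c := by
    intro c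
    funext j
    simp only [Matrix.mulVec, dotProduct]
    exact sum_extend_zero e he c (fun i y => H j i * y) (by simp)
  have hpc : IsParityCheck H' C' := by
    intro c
    rw [mem_punctured C Z hZ e he hrange C' hC', hH, hmul]
  refine ⟨H', hpc, ?_⟩
  by_cases hne : ∃ c ∈ C', c ≠ 0
  · apply le_antisymm
    · obtain ⟨c, hc, h0⟩ := hne
      have hmem : minDist C' ∈ {d | ∃ c ∈ C', c ≠ 0 ∧ hammingNorm c = d} :=
        Nat.sInf_mem ⟨_, c, hc, h0, rfl⟩
      obtain ⟨c, hc, h0, hd⟩ := hmem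
      rw [← hd]
      apply sInf_le
      refine ⟨_, ⟨indicator_mem_fundCone H' c ((hpc c).1 hc), ?_⟩, ?_⟩
      · intro h
        apply h0
        funext i
        have := congrFun h i
        by_contra hci
        simp only [Pi.zero_apply] at this hci
        simp [hci] at this
      · simp only [w_indicator hw c h0]
    · rw [minDist_punctured C Z hZ e he hrange C' hC', ← hmin]
      apply le_sInf
      rintro _ ⟨x, ⟨hx, hx0⟩, rfl⟩
      apply sInf_le
      refine ⟨Function.extend e x 0, ⟨⟨extend_nonneg e he x hx.1, ?_⟩, extend_ne_zero he hx0⟩, ?_⟩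
      · intro j ℓ hℓ
        by_cases h : ∃ k, e k = ℓ
        · obtain ⟨k, rfl⟩ := h
          rw [he.extend_apply, sum_rowSupp_erase he H r H' j j (fun _ => rfl)]
          apply hx.2
          simpa [rowSupp, H'] using hℓ
        · rw [Function.extend_apply' _ _ _ h]
          exact Finset.sum_nonneg fun i _ => extend_nonneg e he x hx.1 i
      · simp only [hw.ext _ _ e he x hx.1]
  · exfalso
    have h0 : minDist C = 0 := by
      rw [← minDist_punctured C Z hZ e he hrange C' hC']
      unfold minDist
      have : {d | ∃ c ∈ C', c ≠ 0 ∧ hammingNorm c = d} = ∅ := by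
        ext d
        simp only [Set.mem_ofPred_eq, Set.mem_empty_iff_false, iff_false]
        rintro ⟨c, hc, h, _⟩
        exact hne ⟨c, hc, h⟩
      rw [this, Nat.sInf_empty]
    have h1 : ((1 : ℝ) : EReal) ≤ minPW (w n) H := by
      apply le_sInf
      rintro _ ⟨x, ⟨hx, hx0⟩, rfl⟩
      exact EReal.coe_le_coe_iff.2 (hw.one_le n x hx.1 hx0)
    rw [hmin, h0, EReal.coe_le_coe_iff] at h1
    norm_num at h1

theorem upper_bound {w : ∀ n : ℕ, (Fin n → ℝ) → ℝ} (hw : GoodW w) {n m t r : ℕ}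
    (C : Submodule (ZMod 2) (Fin n → ZMod 2))
    (Z : Finset (Fin n)) (hZ : ∀ i, i ∈ Z ↔ ∀ c ∈ C, c i = 0) (ht : Z.card = t)
    (e : Fin m → Fin n) (he : Function.Injective e)
    (hrange : Set.range e = (↑Z : Set (Fin n))ᶜ)
    (C' : Submodule (ZMod 2) (Fin m → ZMod 2))
    (hC' : C' = C.map (LinearMap.funLeft (ZMod 2) (ZMod 2) e))
    (H' : Matrix (Fin r) (Fin m) (ZMod 2)) (hH' : IsParityCheck H' C')
    (hmin : minPW (w m) H' = ((minDist C' : ℝ) : EReal)) :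
    ∃ H : Matrix (Fin (r + t)) (Fin n) (ZMod 2), IsParityCheck H C ∧
      minPW (w n) H = ((minDist C : ℝ) : EReal) := by
  let H : Matrix (Fin (r + t)) (Fin n) (ZMod 2) := fun j =>
    Fin.addCases (motive := fun _ => Fin n → ZMod 2) (fun j => Function.extend e (H' j) 0)
      (fun k => Pi.single (Z.orderEmbOfFin ht k) 1) j
  have hHl : ∀ j : Fin r, H (Fin.castAdd t j) = Function.extend e (H' j) 0 := by
    intro j; simp [H]
  have hHr : ∀ k : Fin t, H (Fin.natAdd r k) = Pi.single (Z.orderEmbOfFin ht k) 1 := by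
    intro j; simp [H]
  have hZe : ∀ z ∈ Z, ∃ k : Fin t, Z.orderEmbOfFin ht k = z := by
    intro z hz
    have : z ∈ Set.range (Z.orderEmbOfFin ht) := by
      rw [Finset.range_orderEmbOfFin]; exact hz
    exact this
  have hnZ : ∀ i ∈ Z, ¬ ∃ k, e k = i := by
    intro i hi h
    have : i ∈ Set.range e := h
    rw [hrange] at this
    exact this hi
  have hmulL : ∀ (c : Fin m → ZMod 2) (j : Fin r),
      H.mulVec (Function.extend e c 0) (Fin.castAdd t j) = H'.mulVec c j := by
    intro c j
    simp only [Matrix.mulVec, dotProduct]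
    rw [sum_extend_zero e he c (fun i y => H (Fin.castAdd t j) i * y) (by simp)]
    simp only [hHl, he.extend_apply]
  have hmulR : ∀ (c : Fin n → ZMod 2) (k : Fin t),
      H.mulVec c (Fin.natAdd r k) = c (Z.orderEmbOfFin ht k) := by
    intro c k
    simp only [Matrix.mulVec, hHr]
    simp
  have hpc : IsParityCheck H C := by
    intro c
    constructor
    · intro hc
      have h1 := eq_extend_of he hrange c (fun i hi => (hZ i).1 hi c hc)
      have h2 := hc
      rw [h1, ← mem_punctured C Z hZ e he hrange C' hC', hH'] at h2
      funext j
      refine Fin.addCases (fun j => ?_) (fun k => ?_) j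
      · rw [h1, hmulL, h2]; rfl
      · rw [hmulR]
        exact (hZ _).1 (Finset.orderEmbOfFin_mem Z ht k) c hc
    · intro hc
      have h1 := eq_extend_of he hrange c (fun i hi => by
        obtain ⟨k, rfl⟩ := hZe i hi
        exact (hmulR c k).symm.trans (congrFun hc _))
      rw [h1, ← mem_punctured C Z hZ e he hrange C' hC', hH']
      funext j
      rw [← hmulL, ← h1, hc]; rfl
  refine ⟨H, hpc, ?_⟩
  rw [← minDist_punctured C Z hZ e he hrange C' hC', ← hmin]
  have hrow : ∀ (j : Fin r) (k : Fin m), H (Fin.castAdd t j) (e k) = H' j k := by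
    intro j k; rw [hHl, he.extend_apply]
  have hsupL : ∀ (j : Fin r) (ℓ : Fin n), ℓ ∈ rowSupp H (Fin.castAdd t j) →
      ∃ k ∈ rowSupp H' j, e k = ℓ := by
    intro j ℓ hℓ
    have h1 : H (Fin.castAdd t j) ℓ = 1 := by simpa [rowSupp] using hℓ
    rw [hHl] at h1
    by_cases h : ∃ k, e k = ℓ
    · obtain ⟨k, rfl⟩ := h
      rw [he.extend_apply] at h1
      exact ⟨k, by simp [rowSupp, h1], rfl⟩
    · rw [Function.extend_apply' _ _ _ h] at h1
      simp at h1
  have hsupR : ∀ k : Fin t, rowSupp H (Fin.natAdd r k) = {Z.orderEmbOfFin ht k} := by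
    intro k
    ext i
    simp only [rowSupp, Finset.mem_filter, Finset.mem_univ, true_and, Finset.mem_singleton, hHr]
    by_cases h : i = Z.orderEmbOfFin ht k
    · simp [h]
    · simp [h]
  apply le_antisymm
  · apply le_sInf
    rintro _ ⟨x, ⟨hx, hx0⟩, rfl⟩
    apply sInf_le
    refine ⟨Function.extend e x 0, ⟨⟨extend_nonneg e he x hx.1, ?_⟩, extend_ne_zero he hx0⟩, ?_⟩
    · intro j
      refine Fin.addCases (fun j => ?_) (fun k => ?_) j
      · intro ℓ hℓ
        obtain ⟨k, hk, rfl⟩ := hsupL j ℓ hℓ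
        rw [he.extend_apply, sum_rowSupp_erase he H r H' _ j (hrow j)]
        exact hx.2 j k hk
      · intro ℓ hℓ
        rw [hsupR, Finset.mem_singleton] at hℓ
        rw [Function.extend_apply' _ _ _
          (hnZ ℓ (hℓ ▸ Finset.orderEmbOfFin_mem Z ht k))]
        exact Finset.sum_nonneg fun i _ => extend_nonneg e he x hx.1 i
    · simp only [hw.ext _ _ e he x hx.1]
  · apply le_sInf
    rintro _ ⟨x, ⟨hx, hx0⟩, rfl⟩
    apply sInf_le
    have h1 := eq_extend_of he hrange x (fun i hi => by
      obtain ⟨k, rfl⟩ := hZe i hi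
      have := hx.2 (Fin.natAdd r k) (Z.orderEmbOfFin ht k) (by rw [hsupR]; simp)
      rw [hsupR] at this
      simp at this
      exact le_antisymm this (hx.1 _))
    refine ⟨fun k => x (e k), ⟨⟨fun k => hx.1 _, ?_⟩, ?_⟩, ?_⟩
    · intro j k hk
      have h2 := hx.2 (Fin.castAdd t j) (e k) (by
        simp only [rowSupp, Finset.mem_filter, Finset.mem_univ, true_and, hrow] at hk ⊢
        exact hk)
      rw [← sum_rowSupp_erase he H r H' _ j (hrow j), ← h1]
      exact h2
    · intro h
      have h' : (fun k => x (e k)) = 0 := h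
      apply hx0
      rw [h1, h']
      funext i
      by_cases h : ∃ k, e k = i
      · obtain ⟨k, rfl⟩ := h
        rw [he.extend_apply]; rfl
      · rw [Function.extend_apply' _ _ _ h]
    · have := hw.ext _ _ e he (fun k => x (e k)) (fun k => hx.1 _)
      rw [← h1] at this
      simp only [this]

theorem redundancy_bounds {w : ∀ n : ℕ, (Fin n → ℝ) → ℝ} (hw : GoodW w) {n m t : ℕ}
    (C : Submodule (ZMod 2) (Fin n → ZMod 2))
    (Z : Finset (Fin n)) (hZ : ∀ i, i ∈ Z ↔ ∀ c ∈ C, c i = 0) (ht : Z.card = t)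
    (e : Fin m → Fin n) (he : Function.Injective e)
    (hrange : Set.range e = (↑Z : Set (Fin n))ᶜ)
    (C' : Submodule (ZMod 2) (Fin m → ZMod 2))
    (hC' : C' = C.map (LinearMap.funLeft (ZMod 2) (ZMod 2) e)) :
    pcRedundancy (w m) C' ≤ pcRedundancy (w n) C ∧
      pcRedundancy (w n) C ≤ pcRedundancy (w m) C' + (t : ℕ∞) := by
  constructor
  · apply le_sInf
    rintro _ ⟨r, H, rfl, hH, hmin⟩
    obtain ⟨H', h1, h2⟩ := lower_bound hw C Z hZ e he hrange C' hC' H hH hmin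
    exact sInf_le ⟨r, H', rfl, h1, h2⟩
  · rcases Set.eq_empty_or_nonempty {k : ℕ∞ | ∃ (r : ℕ) (H : Matrix (Fin r) (Fin m) (ZMod 2)),
      k = (r : ℕ∞) ∧ IsParityCheck H C' ∧ minPW (w m) H = ((minDist C' : ℝ) : EReal)} with h | h
    · have : pcRedundancy (w m) C' = ⊤ := by
        unfold pcRedundancy
        rw [h, sInf_empty]
      rw [this, top_add]
      exact le_top
    · have hmem := csInf_mem h
      obtain ⟨r, H', hr, hH', hmin⟩ := hmem
      obtain ⟨H, h1, h2⟩ := upper_bound hw C Z hZ ht e he hrange C' hC' H' hH' hmin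
      have hr' : pcRedundancy (w m) C' = r := hr
      rw [hr']
      exact sInf_le ⟨r + t, H, by push_cast; rfl, h1, h2⟩

/-- If `C` is an `[n,k,d]` code with exactly `t` zero coordinates and `C'` is
the `[n-t,k,d]` code obtained by puncturing `C` at these coordinates, then for each of the
AWGNC and BSC pseudoweights and the max-fractional weight,
`ρ(C') ≤ ρ(C) ≤ ρ(C') + t`. -/
theorem statement2 {n t : ℕ} (C : Submodule (ZMod 2) (Fin n → ZMod 2))
    (Z : Finset (Fin n)) (hZ : ∀ i, i ∈ Z ↔ ∀ c ∈ C, c i = 0) (ht : Z.card = t)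
    (e : Fin (n - t) → Fin n) (he : Function.Injective e)
    (hrange : Set.range e = (↑Z : Set (Fin n))ᶜ)
    (C' : Submodule (ZMod 2) (Fin (n - t) → ZMod 2))
    (hC' : C' = C.map (LinearMap.funLeft (ZMod 2) (ZMod 2) e)) :
    (pcRedundancy wAWGNC C' ≤ pcRedundancy wAWGNC C ∧
      pcRedundancy wAWGNC C ≤ pcRedundancy wAWGNC C' + (t : ℕ∞)) ∧
    (pcRedundancy wBSC C' ≤ pcRedundancy wBSC C ∧
      pcRedundancy wBSC C ≤ pcRedundancy wBSC C' + (t : ℕ∞)) ∧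
    (pcRedundancy wMaxFrac C' ≤ pcRedundancy wMaxFrac C ∧
      pcRedundancy wMaxFrac C ≤ pcRedundancy wMaxFrac C' + (t : ℕ∞)) := by
  exact ⟨redundancy_bounds goodW_AWGNC C Z hZ ht e he hrange C' hC',
    redundancy_bounds goodW_BSC C Z hZ ht e he hrange C' hC',
    redundancy_bounds goodW_MaxFrac C Z hZ ht e he hrange C' hC'⟩
end

section
/- Let C be a binary linear code of length n and dimension 2. Then ρ(C) = n − 2 for each of the AWGNC pseudoweight, the BSC pseudoweight, and the max-fractional weight; i.e., there exists an (n−2)×n parity-check matrix H of C with w^min(H) = d(C) for each of these three pseudoweight types, and no parity-check matrix of C has fewer than n−2 rows. -/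
open Matrix BigOperators Finset

/-- The real 0-1 vector of a binary word. -/
noncomputable def ind01 {n : ℕ} (c : Fin n → ZMod 2) : Fin n → ℝ := fun i => if c i = 1 then 1 else 0

theorem zmod2_cases (a : ZMod 2) : a = 0 ∨ a = 1 := by
  revert a; decide

theorem ind01_nonneg {n : ℕ} (c : Fin n → ZMod 2) (i : Fin n) : 0 ≤ ind01 c i := by
  unfold ind01; split_ifs <;> norm_num

theorem ind01_sum {n : ℕ} (c : Fin n → ZMod 2) : ∑ i, ind01 c i = (hammingNorm c : ℝ) := by
  unfold ind01 hammingNorm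
  rw [Finset.sum_boole]
  congr 2
  ext i
  rcases zmod2_cases (c i) with h | h <;> simp [h]

theorem sum_trunc (n : ℕ) (ξ : ℝ) :
    ∑ i : Fin n, min 1 (max 0 (ξ - (i : ℝ))) = min (n : ℝ) (max 0 ξ) := by
  induction n with
  | zero => simp
  | succ k ih =>
    rw [Fin.sum_univ_castSucc]
    simp only [Fin.val_castSucc, Fin.val_last]
    rw [ih]
    have hk : (0 : ℝ) ≤ k := Nat.cast_nonneg k
    push_cast
    rcases le_total ξ 0 with h | h
    · rw [max_eq_left h, max_eq_left (by linarith : ξ - k ≤ 0), min_eq_right hk,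
        min_eq_right (by norm_num), min_eq_right (by linarith)]; norm_num
    · rw [max_eq_right h]
      rcases le_total ξ k with h1 | h1
      · rw [max_eq_left (by linarith : ξ - k ≤ 0), min_eq_right h1, min_eq_right (by linarith),
          min_eq_right (by linarith)]; norm_num
      · rw [max_eq_right (by linarith : 0 ≤ ξ - k), min_eq_left h1]
        rcases le_total ξ (k + 1) with h2 | h2
        · rw [min_eq_right (by linarith), min_eq_right h2]; ring
        · rw [min_eq_left (by linarith), min_eq_left h2]

theorem sortDesc_sum {n : ℕ} (x : Fin n → ℝ) : ∑ i, sortDesc x i = ∑ i, x i := by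
  unfold sortDesc
  exact Equiv.sum_comp (Tuple.sort (fun j => -x j)) x

theorem bigPhi_top {n : ℕ} (x : Fin n → ℝ) : bigPhi x n = ∑ i, x i := by
  unfold bigPhi
  rw [← sortDesc_sum x]
  refine Finset.sum_congr rfl fun i _ => ?_
  have h : ((i : ℕ) : ℝ) + 1 ≤ n := by exact_mod_cast i.2
  rw [max_eq_right (by linarith), min_eq_left (by linarith), mul_one]

theorem bigPhi_le {n : ℕ} (x : Fin n → ℝ) (M : ℝ) (h0 : 0 ≤ M) (hM : ∀ i, x i ≤ M) (ξ : ℝ) :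
    bigPhi x ξ ≤ M * max 0 ξ := by
  unfold bigPhi
  calc _ ≤ ∑ i : Fin n, M * min 1 (max 0 (ξ - (i : ℝ))) := by
        refine Finset.sum_le_sum fun i _ => mul_le_mul_of_nonneg_right (hM _) ?_
        exact le_min zero_le_one (le_max_left _ _)
    _ = M * min (n : ℝ) (max 0 ξ) := by rw [← Finset.mul_sum, sum_trunc]
    _ ≤ _ := mul_le_mul_of_nonneg_left (min_le_right _ _) h0

/-- The three lower bounds. -/
theorem weights_ge {n : ℕ} (x : Fin n → ℝ) (M d : ℝ) (hd : 0 ≤ d) (hx0 : x ≠ 0) (hx : ∀ i, 0 ≤ x i)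
    (hM : ∀ i, x i ≤ M) (hs : d * M ≤ ∑ i, x i) :
    d ≤ wAWGNC x ∧ d ≤ wBSC x ∧ d ≤ wMaxFrac x := by
  obtain ⟨k, hk⟩ : ∃ k, x k ≠ 0 := by
    by_contra! h; exact hx0 (funext h)
  have hkpos : 0 < x k := lt_of_le_of_ne (hx k) (Ne.symm hk)
  have hMpos : 0 < M := lt_of_lt_of_le hkpos (hM k)
  have hS : 0 < ∑ i, x i := Finset.sum_pos' (fun i _ => hx i) ⟨k, Finset.mem_univ _, hkpos⟩
  have hS2 : 0 < ∑ i, x i ^ 2 :=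
    Finset.sum_pos' (fun i _ => sq_nonneg _) ⟨k, Finset.mem_univ _, by positivity⟩
  refine ⟨?_, ?_, ?_⟩
  · unfold wAWGNC
    rw [le_div_iff₀ hS2]
    have h1 : ∑ i, x i ^ 2 ≤ M * ∑ i, x i := by
      rw [Finset.mul_sum]
      refine Finset.sum_le_sum fun i _ => ?_
      rw [sq]
      exact mul_le_mul_of_nonneg_right (hM i) (hx i)
    calc d * ∑ i, x i ^ 2 ≤ d * (M * ∑ i, x i) := mul_le_mul_of_nonneg_left h1 hd
      _ = (d * M) * ∑ i, x i := by ring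
      _ ≤ (∑ i, x i) * ∑ i, x i := mul_le_mul_of_nonneg_right hs hS.le
      _ = _ := by ring
  · unfold wBSC
    have : d / 2 ≤ sInf {ξ : ℝ | bigPhi x (n : ℝ) / 2 ≤ bigPhi x ξ} := by
      apply le_csInf
      · exact ⟨n, by simp only [Set.mem_ofPred_eq, bigPhi_top]; linarith⟩
      · intro ξ hξ
        simp only [Set.mem_ofPred_eq, bigPhi_top] at hξ
        have h2 := bigPhi_le x M hMpos.le hM ξ
        rcases le_total ξ 0 with h | h
        · rw [max_eq_left h] at h2; linarith
        · rw [max_eq_right h] at h2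
          have : M * (d / 2) ≤ M * ξ := by linarith
          exact le_of_mul_le_mul_left this hMpos
    linarith
  · unfold wMaxFrac
    have h1 : sSup (Set.range x) ≤ M := csSup_le ⟨x k, k, rfl⟩ (by rintro _ ⟨i, rfl⟩; exact hM i)
    have h2 : x k ≤ sSup (Set.range x) := le_csSup ⟨M, by rintro _ ⟨i, rfl⟩; exact hM i⟩ ⟨k, rfl⟩
    rw [le_div_iff₀ (by linarith)]
    exact (mul_le_mul_of_nonneg_left h1 hd).trans hs

/-- The three upper bounds, on codewords. -/
theorem weights_ind {n : ℕ} (c : Fin n → ZMod 2) (hc : c ≠ 0) :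
    wAWGNC (ind01 c) ≤ hammingNorm c ∧ wBSC (ind01 c) ≤ hammingNorm c ∧
      wMaxFrac (ind01 c) ≤ hammingNorm c := by
  obtain ⟨k, hk⟩ : ∃ k, c k ≠ 0 := by
    by_contra! h; exact hc (funext h)
  have hk1 : c k = 1 := (zmod2_cases _).resolve_left hk
  have hik : ind01 c k = 1 := by simp [ind01, hk1]
  have hdpos : (0 : ℝ) < hammingNorm c := by
    exact_mod_cast hammingNorm_pos_iff.2 hc
  have hle : ∀ i, ind01 c i ≤ 1 := by
    intro i; unfold ind01; split_ifs <;> norm_num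
  refine ⟨?_, ?_, ?_⟩
  · unfold wAWGNC
    have : ∑ i, ind01 c i ^ 2 = ∑ i, ind01 c i := by
      refine Finset.sum_congr rfl fun i _ => ?_
      unfold ind01; split_ifs <;> norm_num
    rw [this, ind01_sum, sq, mul_div_cancel_right₀ _ hdpos.ne']
  · unfold wBSC
    have hbd : BddBelow {ξ : ℝ | bigPhi (ind01 c) (n : ℝ) / 2 ≤ bigPhi (ind01 c) ξ} := by
      refine ⟨0, fun ξ hξ => ?_⟩
      simp only [Set.mem_ofPred_eq, bigPhi_top, ind01_sum] at hξ
      by_contra! h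
      have h2 := bigPhi_le (ind01 c) 1 zero_le_one hle ξ
      rw [max_eq_left h.le] at h2
      linarith
    have hmem : (hammingNorm c : ℝ) / 2 ∈
        {ξ : ℝ | bigPhi (ind01 c) (n : ℝ) / 2 ≤ bigPhi (ind01 c) ξ} := by
      simp only [Set.mem_ofPred_eq, bigPhi_top, ind01_sum]
      have key : bigPhi (ind01 c) ((hammingNorm c : ℝ) / 2) =
          ∑ i : Fin n, min 1 (max 0 ((hammingNorm c : ℝ) / 2 - (i : ℝ))) := by
        unfold bigPhi
        refine Finset.sum_congr rfl fun i _ => ?_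
        have h01 : ∀ j, sortDesc (ind01 c) j = 0 ∨ sortDesc (ind01 c) j = 1 := by
          intro j; unfold sortDesc ind01; split_ifs <;> simp
        rcases h01 i with h | h
        · have hsum : (hammingNorm c : ℝ) ≤ (i : ℕ) := by
            rw [← ind01_sum, ← sortDesc_sum]
            calc ∑ j, sortDesc (ind01 c) j ≤ ∑ j, (if j < i then (1 : ℝ) else 0) := by
                  refine Finset.sum_le_sum fun j _ => ?_
                  split_ifs with hj
                  · rcases h01 j with h' | h' <;> rw [h'] <;> norm_num
                  · have := sortDesc_antitone (ind01 c) (not_lt.1 hj)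
                    linarith
              _ = _ := by
                rw [Finset.sum_boole]
                congr 1
                rw [Finset.filter_gt_eq_Iio, Fin.card_Iio]
          rw [h, max_eq_left (by linarith)]
          norm_num
        · rw [h, one_mul]
      rw [key, sum_trunc]
      have hn : (hammingNorm c : ℝ) ≤ n := by
        have := hammingNorm_le_card_fintype (x := c)
        rw [Fintype.card_fin] at this
        exact_mod_cast this
      rw [max_eq_right (by linarith), min_eq_right (by linarith)]
    have := csInf_le hbd hmem
    linarith
  · unfold wMaxFrac
    have h2 : ind01 c k ≤ sSup (Set.range (ind01 c)) :=
      le_csSup ⟨1, by rintro _ ⟨i, rfl⟩; exact hle i⟩ ⟨k, rfl⟩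
    rw [hik] at h2
    rw [ind01_sum, div_le_iff₀ (by linarith)]
    nlinarith

theorem mulVec_rowSupp {m n : ℕ} (H : Matrix (Fin m) (Fin n) (ZMod 2)) (c : Fin n → ZMod 2)
    (j : Fin m) : H.mulVec c j = ∑ i ∈ rowSupp H j, c i := by
  unfold rowSupp
  rw [Finset.sum_filter]
  simp only [Matrix.mulVec, dotProduct]
  refine Finset.sum_congr rfl fun i _ => ?_
  rcases zmod2_cases (H j i) with h | h <;> simp [h]

theorem ind01_mem_cone {m n : ℕ} (H : Matrix (Fin m) (Fin n) (ZMod 2)) (c : Fin n → ZMod 2)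
    (hc : H.mulVec c = 0) : ind01 c ∈ fundCone H := by
  refine ⟨ind01_nonneg c, fun j l hl => ?_⟩
  have h0 : ∑ i ∈ rowSupp H j, c i = 0 := by rw [← mulVec_rowSupp, hc]; rfl
  by_cases hcl : c l = 1
  · obtain ⟨i, hi, hci⟩ : ∃ i ∈ (rowSupp H j).erase l, c i ≠ 0 := by
      by_contra! h
      rw [← Finset.add_sum_erase _ _ hl, Finset.sum_eq_zero h, hcl] at h0
      simp at h0
    have h1 : c i = 1 := (zmod2_cases _).resolve_left hci
    calc ind01 c l = ind01 c i := by simp [ind01, hcl, h1]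
      _ ≤ _ := Finset.single_le_sum (fun i _ => ind01_nonneg c i) hi
  · calc ind01 c l = 0 := by simp [ind01, hcl]
      _ ≤ _ := Finset.sum_nonneg fun i _ => ind01_nonneg c i

theorem exists_systematic {n : ℕ} (C : Submodule (ZMod 2) (Fin n → ZMod 2))
    (hdim : Module.finrank (ZMod 2) C = 2) :
    ∃ u ∈ C, ∃ v ∈ C, ∃ r1 r2 : Fin n, u r1 = 1 ∧ u r2 = 0 ∧ v r1 = 0 ∧ v r2 = 1 ∧
      ∀ c, c ∈ C ↔ ∀ i, c i = c r1 * u i + c r2 * v i := by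
  have hne : C ≠ ⊥ := by rintro rfl; simp at hdim
  obtain ⟨w, hw, hw0⟩ := (Submodule.ne_bot_iff _).1 hne
  obtain ⟨r1, hr1⟩ : ∃ k, w k ≠ 0 := by
    by_contra! h; exact hw0 (funext h)
  have hr1 : w r1 = 1 := (zmod2_cases _).resolve_left hr1
  let f : C →ₗ[ZMod 2] ZMod 2 := (LinearMap.proj r1).comp C.subtype
  have hf : LinearMap.ker f ≠ ⊥ := LinearMap.ker_ne_bot_of_finrank_lt (by rw [hdim]; simp)
  obtain ⟨⟨v, hv⟩, hvk, hv0⟩ := (Submodule.ne_bot_iff _).1 hf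
  have hvr1 : v r1 = 0 := hvk
  have hv0' : v ≠ 0 := by rintro rfl; exact hv0 rfl
  obtain ⟨r2, hr2⟩ : ∃ k, v k ≠ 0 := by
    by_contra! h; exact hv0' (funext h)
  have hr2 : v r2 = 1 := (zmod2_cases _).resolve_left hr2
  obtain ⟨u, hu, hu1, hu2⟩ : ∃ u ∈ C, u r1 = 1 ∧ u r2 = 0 := by
    refine ⟨w - w r2 • v, C.sub_mem hw (C.smul_mem _ hv), ?_, ?_⟩
    · simp [hr1, hvr1]
    · simp [hr2]
  refine ⟨u, hu, v, hv, r1, r2, hu1, hu2, hvr1, hr2, fun c => ⟨fun hc => ?_, fun h => ?_⟩⟩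
  · let g : C →ₗ[ZMod 2] (ZMod 2 × ZMod 2) :=
      ((LinearMap.proj r1).comp C.subtype).prod ((LinearMap.proj r2).comp C.subtype)
    have hsurj : Function.Surjective g := by
      rintro ⟨a, b⟩
      refine ⟨⟨a • u + b • v, C.add_mem (C.smul_mem _ hu) (C.smul_mem _ hv)⟩, ?_⟩
      simp [g, hu1, hu2, hvr1, hr2]
    have hinj : Function.Injective g :=
      (LinearMap.injective_iff_surjective_of_finrank_eq_finrank (by rw [hdim]; simp)).2 hsurj
    have : (⟨c, hc⟩ : C) =
        ⟨c r1 • u + c r2 • v, C.add_mem (C.smul_mem _ hu) (C.smul_mem _ hv)⟩ := by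
      apply hinj
      simp [g, hu1, hu2, hvr1, hr2]
    intro i
    have := congrFun (congrArg Subtype.val this) i
    simpa using this
  · have : c = c r1 • u + c r2 • v := by
      funext i; rw [h i]; simp [hu1, hu2, hvr1, hr2]
    rw [this]
    exact C.add_mem (C.smul_mem _ hu) (C.smul_mem _ hv)

theorem rows_ge {n : ℕ} (C : Submodule (ZMod 2) (Fin n → ZMod 2))
    (hdim : Module.finrank (ZMod 2) C = 2) (m : ℕ) (H : Matrix (Fin m) (Fin n) (ZMod 2))
    (hH : IsParityCheck H C) : n - 2 ≤ m := by
  have hk : LinearMap.ker H.mulVecLin = C := by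
    ext c; rw [LinearMap.mem_ker, Matrix.mulVecLin_apply, hH c]
  have h1 := LinearMap.finrank_range_add_finrank_ker H.mulVecLin
  rw [hk, hdim] at h1
  have h2 := Submodule.finrank_le (LinearMap.range H.mulVecLin)
  simp at h1 h2
  omega

/-- Good parity-check matrix: the cone is generated by the codewords. -/
theorem exists_good {n : ℕ} (C : Submodule (ZMod 2) (Fin n → ZMod 2))
    (hdim : Module.finrank (ZMod 2) C = 2) :
    ∃ H : Matrix (Fin (n - 2)) (Fin n) (ZMod 2), IsParityCheck H C ∧
      ∀ x ∈ fundCone H, ∃ M : ℝ, (∀ i, x i ≤ M) ∧ (minDist C : ℝ) * M ≤ ∑ i, x i := by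
  obtain ⟨u, hu, v, hv, r1, r2, hu1, hu2, hv1, hv2, hC⟩ := exists_systematic C hdim
  have h12 : r1 ≠ r2 := by rintro rfl; rw [hu1] at hu2; exact one_ne_zero hu2
  obtain ⟨r3, hr3⟩ : ∃ r3, ∀ i, u i = 1 → v i = 1 → u r3 = 1 ∧ v r3 = 1 := by
    by_cases h : ∃ i, u i = 1 ∧ v i = 1
    · obtain ⟨i, hi⟩ := h; exact ⟨i, fun _ _ _ => hi⟩
    · exact ⟨r1, fun i h1 h2 => (h ⟨i, h1, h2⟩).elim⟩
  let supp : Fin n → Finset (Fin n) := fun i =>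
    if u i = 1 then (if v i = 1 then (if i = r3 then {i, r1, r2} else {i, r3}) else {i, r1})
    else (if v i = 1 then {i, r2} else {i})
  have hcard : Fintype.card (Fin (n - 2)) = Fintype.card {i // i ∉ ({r1, r2} : Finset (Fin n))} := by
    rw [Fintype.card_fin, Fintype.card_subtype_compl, Fintype.card_fin, Fintype.card_coe,
      Finset.card_pair h12]
  let e := Fintype.equivOfCardEq hcard
  let H : Matrix (Fin (n - 2)) (Fin n) (ZMod 2) := fun j k => if k ∈ supp (e j) then 1 else 0
  have hrow : ∀ j, rowSupp H j = supp (e j) := by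
    intro j; ext k; simp [rowSupp, H]
  refine ⟨H, fun c => ?_, fun x hx => ?_⟩
  · rw [hC c]
    have hH : H.mulVec c = 0 ↔ ∀ i, i ≠ r1 → i ≠ r2 → ∑ k ∈ supp i, c k = 0 := by
      constructor
      · intro h i h1 h2
        have hi : i ∉ ({r1, r2} : Finset (Fin n)) := by simp [h1, h2]
        have := congrFun h (e.symm ⟨i, hi⟩)
        rw [mulVec_rowSupp, hrow] at this
        simpa using this
      · intro h
        funext j
        rw [mulVec_rowSupp, hrow]
        have := (e j).2
        simp only [Finset.mem_insert, Finset.mem_singleton, not_or] at this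
        exact h _ this.1 this.2
    rw [hH]
    have z2 : ∀ a b : ZMod 2, a + b = 0 ↔ a = b := by decide
    constructor
    · intro h i h1 h2
      have hi := h i
      have h3 := h r3
      simp only [supp]
      rcases zmod2_cases (u i) with ha | ha <;> rcases zmod2_cases (v i) with hb | hb
      · simp [ha, hb] at hi ⊢; exact hi
      · simp [ha, hb] at hi ⊢; rw [Finset.sum_pair h2, hi, z2]
      · simp [ha, hb] at hi ⊢; rw [Finset.sum_pair h1, hi, z2]
      · obtain ⟨h4, h5⟩ := hr3 i ha hb
        simp [ha, hb] at hi ⊢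
        simp [h4, h5] at h3
        split_ifs with h6
        · rw [Finset.sum_insert (by simp [h1, h2]), Finset.sum_pair h12, z2, hi]
        · rw [Finset.sum_pair h6, z2, hi, h3]
    · intro h i
      by_cases h1 : i = r1
      · subst h1; simp [hu1, hv1]
      by_cases h2 : i = r2
      · subst h2; simp [hu2, hv2]
      have hi := h i h1 h2
      rcases zmod2_cases (u i) with ha | ha <;> rcases zmod2_cases (v i) with hb | hb
      · simpa [supp, ha, hb] using hi
      · simp [supp, ha, hb] at hi ⊢; rwa [Finset.sum_pair h2, z2] at hi
      · simp [supp, ha, hb] at hi ⊢; rwa [Finset.sum_pair h1, z2] at hi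
      · obtain ⟨h4, h5⟩ := hr3 i ha hb
        have h31 : r3 ≠ r1 := by rintro rfl; rw [hv1] at h5; exact zero_ne_one h5
        have h32 : r3 ≠ r2 := by rintro rfl; rw [hu2] at h4; exact zero_ne_one h4
        have h3 := h r3 h31 h32
        simp only [supp, h4, h5, if_true] at h3
        rw [Finset.sum_insert (by simp [h31, h32]), Finset.sum_pair h12, z2] at h3
        by_cases h6 : i = r3
        · subst h6; simp [ha, hb, h3]
        · simp [supp, ha, hb, h6] at hi ⊢
          rw [z2] at hi
          rw [hi, h3]
  · obtain ⟨hx0, hx1⟩ := hx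
    have hcone : ∀ i, i ≠ r1 → i ≠ r2 → ∀ l ∈ supp i, x l + x l ≤ ∑ k ∈ supp i, x k := by
      intro i h1 h2 l hl
      have hi : i ∉ ({r1, r2} : Finset (Fin n)) := by simp [h1, h2]
      have := hx1 (e.symm ⟨i, hi⟩) l
      rw [hrow] at this
      simp only [Equiv.apply_symm_apply] at this
      have h3 := this hl
      rw [← Finset.add_sum_erase _ _ hl]
      linarith
    have f00 : ∀ i, u i = 0 → v i = 0 → x i = 0 := by
      intro i ha hb
      have h1 : i ≠ r1 := by rintro rfl; simp [hu1] at ha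
      have h2 : i ≠ r2 := by rintro rfl; simp [hv2] at hb
      have := hcone i h1 h2 i
      simp [supp, ha, hb] at this
      exact le_antisymm this (hx0 i)
    have f10 : ∀ i, u i = 1 → v i = 0 → x i = x r1 := by
      intro i ha hb
      by_cases h1 : i = r1
      · rw [h1]
      have h2 : i ≠ r2 := by rintro rfl; simp [hv2] at hb
      have := hcone i h1 h2
      simp [supp, ha, hb] at this
      rw [Finset.sum_pair h1] at this
      linarith [this.1, this.2]
    have f01 : ∀ i, u i = 0 → v i = 1 → x i = x r2 := by
      intro i ha hb
      by_cases h2 : i = r2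
      · rw [h2]
      have h1 : i ≠ r1 := by rintro rfl; simp [hu1] at ha
      have := hcone i h1 h2
      simp [supp, ha, hb] at this
      rw [Finset.sum_pair h2] at this
      linarith [this.1, this.2]
    have f11 : ∀ i, u i = 1 → v i = 1 → x i = x r3 := by
      intro i ha hb
      by_cases h3 : i = r3
      · rw [h3]
      have h1 : i ≠ r1 := by rintro rfl; simp [hv1] at hb
      have h2 : i ≠ r2 := by rintro rfl; simp [hu2] at ha
      have := hcone i h1 h2
      simp [supp, ha, hb, h3] at this
      linarith [this.1, this.2]
    obtain ⟨α, β, γ, hα, hβ, hγ, hdec⟩ : ∃ α β γ : ℝ, 0 ≤ α ∧ 0 ≤ β ∧ 0 ≤ γ ∧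
        ∀ i, x i = α * ind01 u i + β * ind01 v i + γ * ind01 (u + v) i := by
      by_cases hex : ∃ i, u i = 1 ∧ v i = 1
      · obtain ⟨i0, hi1, hi2⟩ := hex
        obtain ⟨h4, h5⟩ := hr3 i0 hi1 hi2
        have h31 : r3 ≠ r1 := by rintro rfl; rw [hv1] at h5; exact zero_ne_one h5
        have h32 : r3 ≠ r2 := by rintro rfl; rw [hu2] at h4; exact zero_ne_one h4
        have h3 := hcone r3 h31 h32
        simp only [supp, h4, h5, if_true] at h3
        rw [Finset.sum_insert (by simp [h31, h32]), Finset.sum_pair h12] at h3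
        have ha := h3 r1 (by simp)
        have hb := h3 r2 (by simp)
        have hc := h3 r3 (by simp)
        refine ⟨(x r1 + x r3 - x r2) / 2, (x r2 + x r3 - x r1) / 2, (x r1 + x r2 - x r3) / 2,
          by linarith, by linarith, by linarith, fun i => ?_⟩
        rcases zmod2_cases (u i) with ha | ha <;> rcases zmod2_cases (v i) with hb | hb
        · rw [f00 i ha hb]; simp [ind01, ha, hb]
        · rw [f01 i ha hb]; simp [ind01, ha, hb]; ring
        · rw [f10 i ha hb]; simp [ind01, ha, hb]; ring
        · rw [f11 i ha hb]
          have : (1 : ZMod 2) + 1 = 0 := by decide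
          simp [ind01, ha, hb, this]; ring
      · refine ⟨x r1, x r2, 0, hx0 _, hx0 _, le_rfl, fun i => ?_⟩
        rcases zmod2_cases (u i) with ha | ha <;> rcases zmod2_cases (v i) with hb | hb
        · rw [f00 i ha hb]; simp [ind01, ha, hb]
        · rw [f01 i ha hb]; simp [ind01, ha, hb]
        · rw [f10 i ha hb]; simp [ind01, ha, hb]
        · exact (hex ⟨i, ha, hb⟩).elim
    have hmin : ∀ c ∈ C, c ≠ 0 → (minDist C : ℝ) ≤ hammingNorm c := by
      intro c hc h0
      have : minDist C ≤ hammingNorm c := Nat.sInf_le ⟨c, hc, h0, rfl⟩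
      exact_mod_cast this
    have hle : ∀ (c : Fin n → ZMod 2) i, ind01 c i ≤ 1 := by
      intro c i; unfold ind01; split_ifs <;> norm_num
    refine ⟨α + β + γ, fun i => ?_, ?_⟩
    · rw [hdec i]
      nlinarith [mul_le_mul_of_nonneg_left (hle u i) hα, mul_le_mul_of_nonneg_left (hle v i) hβ,
        mul_le_mul_of_nonneg_left (hle (u + v) i) hγ]
    · have hu0 : u ≠ 0 := by rintro rfl; simp at hu1
      have hv0 : v ≠ 0 := by rintro rfl; simp at hv2
      have huv0 : u + v ≠ 0 := by
        intro h
        have := congrFun h r1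
        simp [hu1, hv1] at this
      have e1 : ∑ i, x i = α * hammingNorm u + β * hammingNorm v + γ * hammingNorm (u + v) := by
        rw [← ind01_sum, ← ind01_sum, ← ind01_sum, Finset.mul_sum, Finset.mul_sum, Finset.mul_sum,
          ← Finset.sum_add_distrib, ← Finset.sum_add_distrib]
        exact Finset.sum_congr rfl fun i _ => hdec i
      rw [e1]
      nlinarith [mul_le_mul_of_nonneg_left (hmin u hu hu0) hα,
        mul_le_mul_of_nonneg_left (hmin v hv hv0) hβ,
        mul_le_mul_of_nonneg_left (hmin (u + v) (C.add_mem hu hv) huv0) hγ]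

theorem minPW_eq {m n : ℕ} (w : (Fin n → ℝ) → ℝ) (H : Matrix (Fin m) (Fin n) (ZMod 2)) (d : ℝ)
    (h1 : ∀ x ∈ fundCone H, x ≠ 0 → d ≤ w x) (h2 : ∃ x ∈ fundCone H, x ≠ 0 ∧ w x ≤ d) :
    minPW w H = (d : EReal) := by
  unfold minPW
  apply le_antisymm
  · obtain ⟨x, hx, hx0, hw⟩ := h2
    exact le_trans (sInf_le (Set.mem_image_of_mem _ ⟨hx, hx0⟩)) (EReal.coe_le_coe_iff.2 hw)
  · apply le_sInf
    rintro _ ⟨x, ⟨hx, hx0⟩, rfl⟩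
    exact EReal.coe_le_coe_iff.2 (h1 x hx hx0)

theorem redundancy_eq {n : ℕ} (w : (Fin n → ℝ) → ℝ) (C : Submodule (ZMod 2) (Fin n → ZMod 2))
    (hdim : Module.finrank (ZMod 2) C = 2) (H : Matrix (Fin (n - 2)) (Fin n) (ZMod 2))
    (hH : IsParityCheck H C) (hw : minPW w H = ((minDist C : ℝ) : EReal)) :
    pcRedundancy w C = ((n - 2 : ℕ) : ℕ∞) := by
  unfold pcRedundancy
  apply le_antisymm
  · exact sInf_le ⟨n - 2, H, rfl, hH, hw⟩
  · apply le_sInf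
    rintro _ ⟨m, H', rfl, hH', -⟩
    exact_mod_cast rows_ge C hdim m H' hH'

/-- For a binary linear code `C` of length `n` and dimension 2,
`ρ(C) = n - 2` for each of the AWGNC and BSC pseudoweights and the max-fractional weight;
i.e., there is an `(n-2) × n` parity-check matrix of `C` whose minimum pseudoweight equals
`d(C)` for each of the three types, and no parity-check matrix of `C` has fewer than `n-2`
rows. -/
theorem statement9 {n : ℕ} (C : Submodule (ZMod 2) (Fin n → ZMod 2))
    (hdim : Module.finrank (ZMod 2) C = 2) :
    pcRedundancy wAWGNC C = ((n - 2 : ℕ) : ℕ∞) ∧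
    pcRedundancy wBSC C = ((n - 2 : ℕ) : ℕ∞) ∧
    pcRedundancy wMaxFrac C = ((n - 2 : ℕ) : ℕ∞) ∧
    (∃ H : Matrix (Fin (n - 2)) (Fin n) (ZMod 2), IsParityCheck H C ∧
      minPW wAWGNC H = ((minDist C : ℝ) : EReal) ∧
      minPW wBSC H = ((minDist C : ℝ) : EReal) ∧
      minPW wMaxFrac H = ((minDist C : ℝ) : EReal)) ∧
    ∀ (m : ℕ) (H : Matrix (Fin m) (Fin n) (ZMod 2)), IsParityCheck H C → n - 2 ≤ m := by
  obtain ⟨H, hH, hgood⟩ := exists_good C hdim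
  have hne : C ≠ ⊥ := by rintro rfl; simp at hdim
  obtain ⟨c0, hc0, hc00⟩ := (Submodule.ne_bot_iff _).1 hne
  obtain ⟨c, hc, hcne, hcd⟩ : minDist C ∈ {d | ∃ c ∈ C, c ≠ 0 ∧ hammingNorm c = d} :=
    Nat.sInf_mem ⟨_, c0, hc0, hc00, rfl⟩
  have hmem := ind01_mem_cone H c ((hH c).1 hc)
  have hi0 : ind01 c ≠ 0 := by
    intro h
    have := ind01_sum c
    rw [h] at this
    simp only [Pi.zero_apply, Finset.sum_const_zero] at this
    exact hcne (hammingNorm_eq_zero.1 (by exact_mod_cast this.symm))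
  obtain ⟨w1, w2, w3⟩ := weights_ind c hcne
  rw [hcd] at w1 w2 w3
  have hlow : ∀ x ∈ fundCone H, x ≠ 0 →
      (minDist C : ℝ) ≤ wAWGNC x ∧ (minDist C : ℝ) ≤ wBSC x ∧ (minDist C : ℝ) ≤ wMaxFrac x := by
    intro x hx hx0
    obtain ⟨M, hM, hs⟩ := hgood x hx
    exact weights_ge x M _ (Nat.cast_nonneg _) hx0 hx.1 hM hs
  have e1 := minPW_eq wAWGNC H (minDist C) (fun x hx h0 => (hlow x hx h0).1) ⟨_, hmem, hi0, w1⟩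
  have e2 := minPW_eq wBSC H (minDist C) (fun x hx h0 => (hlow x hx h0).2.1) ⟨_, hmem, hi0, w2⟩
  have e3 := minPW_eq wMaxFrac H (minDist C) (fun x hx h0 => (hlow x hx h0).2.2) ⟨_, hmem, hi0, w3⟩
  exact ⟨redundancy_eq _ C hdim H hH e1, redundancy_eq _ C hdim H hH e2,
    redundancy_eq _ C hdim H hH e3, ⟨H, hH, e1, e2, e3⟩, rows_ge C hdim⟩
end

section
/- Let H be the 5×8 matrix over 𝔽₂ with rows (1,0,0,1,1,0,0,1), (0,1,0,1,0,1,0,1), (0,0,1,1,0,0,1,1), (1,1,1,1,0,0,0,0), (0,0,0,0,1,1,1,1). Then C = ker H is a binary linear code of length 8, dimension 4, and minimum Hamming distance 4 (the extended Hamming code), and w_AWGNC^min(H) = 4; in particular the AWGNC pseudocodeword redundancy of C satisfies ρ_AWGNC(C) ≤ 5. -/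
open Matrix BigOperators Finset

/-- The particular 5×8 redundant parity-check matrix of the [8,4,4] extended Hamming code. -/
def H17 : Matrix (Fin 5) (Fin 8) (ZMod 2) :=
  !![1,0,0,1,1,0,0,1;
     0,1,0,1,0,1,0,1;
     0,0,1,1,0,0,1,1;
     1,1,1,1,0,0,0,0;
     0,0,0,0,1,1,1,1]

/-- The [8,4,4] extended Hamming code, as the kernel of `H17`. -/
noncomputable def C17 : Submodule (ZMod 2) (Fin 8 → ZMod 2) :=
  LinearMap.ker H17.mulVecLin

set_option linter.unusedVariables false

/-- The inequalities of the fundamental cone, in terms of the sums `s i` and differences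
`d i` of the paired coordinates `x i`, `x (i + 4)`. -/
structure PairCone (s0 s1 s2 s3 d0 d1 d2 d3 : ℝ) : Prop where
  n0p : 0 ≤ s0 + d0
  n0m : 0 ≤ s0 - d0
  n1p : 0 ≤ s1 + d1
  n1m : 0 ≤ s1 - d1
  n2p : 0 ≤ s2 + d2
  n2m : 0 ≤ s2 - d2
  n3p : 0 ≤ s3 + d3
  n3m : 0 ≤ s3 - d3
  r0p : 0 ≤ s3 + d0
  t0p : 0 ≤ s0 + d3
  r0m : 0 ≤ s3 - d0
  t0m : 0 ≤ s0 - d3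
  r1p : 0 ≤ s3 + d1
  t1p : 0 ≤ s1 + d3
  r1m : 0 ≤ s3 - d1
  t1m : 0 ≤ s1 - d3
  r2p : 0 ≤ s3 + d2
  t2p : 0 ≤ s2 + d3
  r2m : 0 ≤ s3 - d2
  t2m : 0 ≤ s2 - d3
  q0p : 0 ≤ -s0 + s1 + s2 + s3 - d0 + d1 + d2 + d3
  q0m : 0 ≤ -s0 + s1 + s2 + s3 + d0 - d1 - d2 - d3
  q1p : 0 ≤ s0 - s1 + s2 + s3 + d0 - d1 + d2 + d3
  q1m : 0 ≤ s0 - s1 + s2 + s3 - d0 + d1 - d2 - d3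
  q2p : 0 ≤ s0 + s1 - s2 + s3 + d0 + d1 - d2 + d3
  q2m : 0 ≤ s0 + s1 - s2 + s3 - d0 - d1 + d2 - d3
  q3p : 0 ≤ s0 + s1 + s2 - s3 + d0 + d1 + d2 - d3
  q3m : 0 ≤ s0 + s1 + s2 - s3 - d0 - d1 - d2 + d3

lemma core_min3 (s0 s1 s2 s3 d0 d1 d2 d3 : ℝ)
    (hC : PairCone s0 s1 s2 s3 d0 d1 d2 d3)
    (m0 : 0 ≤ s0 - s3) (m1 : 0 ≤ s1 - s3) (m2 : 0 ≤ s2 - s3) :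
    2 * (d0 ^ 2 + d1 ^ 2 + d2 ^ 2 + d3 ^ 2) ≤
      (s0 + s1 + s2 + s3) ^ 2 - 2 * (s0 ^ 2 + s1 ^ 2 + s2 ^ 2 + s3 ^ 2) := by
  obtain ⟨n0p, n0m, n1p, n1m, n2p, n2m, n3p, n3m, r0p, t0p, r0m, t0m, r1p, t1p,
    r1m, t1m, r2p, t2p, r2m, t2m, q0p, q0m, q1p, q1m, q2p, q2m, q3p, q3m⟩ := hC
  linarith [mul_nonneg n0p r0m, mul_nonneg r2p r2m, mul_nonneg n1m r1p,
        mul_nonneg r1p r1m, mul_nonneg q2p m2, mul_nonneg q0p m0, mul_nonneg q1p m1,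
        mul_nonneg q0m m0, mul_nonneg r2m m1, mul_nonneg r1m m2, mul_nonneg n3p n3m,
        mul_nonneg r0m m1, mul_nonneg n2m r2p, mul_nonneg r0m m2, mul_nonneg n0m r0p,
        mul_nonneg q1m m1, mul_nonneg n3m t2p, mul_nonneg q2m m2, mul_nonneg n3m t1p]

lemma core_ppp (s0 s1 s2 s3 d0 d1 d2 d3 : ℝ)
    (hC : PairCone s0 s1 s2 s3 d0 d1 d2 d3)
    (m1 : 0 ≤ -s0 + s1) (m2 : 0 ≤ -s0 + s2) (m3 : 0 ≤ -s0 + s3) (o : 0 ≤ -s1 + s2) (e0 : 0 ≤ d0) (e1 : 0 ≤ d1) (e2 : 0 ≤ d2) (e3 : 0 ≤ d3) :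
    2 * (d0 ^ 2 + d1 ^ 2 + d2 ^ 2 + d3 ^ 2) ≤
      (s0 + s1 + s2 + s3) ^ 2 - 2 * (s0 ^ 2 + s1 ^ 2 + s2 ^ 2 + s3 ^ 2) := by
  obtain ⟨n0p, n0m, n1p, n1m, n2p, n2m, n3p, n3m, r0p, t0p, r0m, t0m, r1p, t1p,
    r1m, t1m, r2p, t2p, r2m, t2m, q0p, q0m, q1p, q1m, q2p, q2m, q3p, q3m⟩ := hC
  rcases le_total s2 s3 with h | h
  · have o2 : 0 ≤ -s2 + s3 := by linarith
    linarith [mul_nonneg q1p m1, mul_nonneg q1p q3m, mul_nonneg n0m e1,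
        mul_nonneg n2m q2m, mul_nonneg q2m e0, mul_nonneg q1m e0, mul_nonneg n3m q3m,
        mul_nonneg n0p n3m, mul_nonneg n0m t0m, mul_nonneg n1m r2m, mul_nonneg q2p o,
        mul_nonneg q3p o2, mul_nonneg n0m m2, mul_nonneg n2p q3m, mul_nonneg n1m o2,
        mul_nonneg t2m e3, mul_nonneg n2m q2p, mul_nonneg q3p o, mul_nonneg n0p m1,
        mul_nonneg q0m e1, mul_nonneg r2m e2, mul_nonneg n1m q3m, mul_nonneg n1p o2,
        mul_nonneg t0m q1p, mul_nonneg n0m e0, mul_nonneg n1p o, mul_nonneg t0m q0p,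
        mul_nonneg n1m e1, mul_nonneg n0p m3, mul_nonneg n0m q3m, mul_nonneg q1m o2]
  rcases le_total s1 s3 with h' | h'
  · have o2 : 0 ≤ -s1 + s3 := by linarith
    have o3 : 0 ≤ s2 - s3 := by linarith
    linarith [mul_nonneg n2m q2m, mul_nonneg n1m e1, mul_nonneg t0m e3,
        mul_nonneg t1m q3m, mul_nonneg r1m m1, mul_nonneg t0m e2, mul_nonneg n1m o,
        mul_nonneg r1m t1m, mul_nonneg q3m e2, mul_nonneg n0m o3, mul_nonneg q2p q2m,
        mul_nonneg n0m q3m, mul_nonneg r2m q3p, mul_nonneg n0p r2m, mul_nonneg q2p o3,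
        mul_nonneg r1m e1, mul_nonneg r2m e2, mul_nonneg t0m e1, mul_nonneg t0m m3,
        mul_nonneg t0m o2, mul_nonneg n0m n1m, mul_nonneg t0p r2m, mul_nonneg n0p m1,
        mul_nonneg r0m t0m, mul_nonneg n3m q3m, mul_nonneg t0m o, mul_nonneg n0m e0,
        mul_nonneg n1m q1m, mul_nonneg n1p o2, mul_nonneg n3m q2p, mul_nonneg n0p n1m]
  · have o2 : 0 ≤ s1 - s3 := by linarith
    linarith [mul_nonneg n2p r2m, mul_nonneg n1p r1m, mul_nonneg r1m q3p,
        mul_nonneg t0p o2, mul_nonneg n0m t0m, mul_nonneg t0m q0p, mul_nonneg n3m e3,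
        mul_nonneg n0m r1m, mul_nonneg n2m q2m, mul_nonneg n0m e0, mul_nonneg n0m r2m,
        mul_nonneg n0p r0m, mul_nonneg n3p o2, mul_nonneg n0p n0m, mul_nonneg q1m e3,
        mul_nonneg n2p t0m, mul_nonneg n3m e0, mul_nonneg n0p q2m, mul_nonneg n0p m1,
        mul_nonneg n1m e1, mul_nonneg q3m e2, mul_nonneg t0p r2m, mul_nonneg q2p o,
        mul_nonneg n1p t0m, mul_nonneg t0p m1, mul_nonneg n1m q1m, mul_nonneg n0m o,
        mul_nonneg r2m q3p, mul_nonneg n1m r2m]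

lemma core_ppm (s0 s1 s2 s3 d0 d1 d2 d3 : ℝ)
    (hC : PairCone s0 s1 s2 s3 d0 d1 d2 d3)
    (m1 : 0 ≤ -s0 + s1) (m2 : 0 ≤ -s0 + s2) (m3 : 0 ≤ -s0 + s3) (o : 0 ≤ -s1 + s2) (e0 : 0 ≤ d0) (e1 : 0 ≤ d1) (e2 : 0 ≤ d2) (e3 : 0 ≤ -d3) :
    2 * (d0 ^ 2 + d1 ^ 2 + d2 ^ 2 + d3 ^ 2) ≤
      (s0 + s1 + s2 + s3) ^ 2 - 2 * (s0 ^ 2 + s1 ^ 2 + s2 ^ 2 + s3 ^ 2) := by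
  obtain ⟨n0p, n0m, n1p, n1m, n2p, n2m, n3p, n3m, r0p, t0p, r0m, t0m, r1p, t1p,
    r1m, t1m, r2p, t2p, r2m, t2m, q0p, q0m, q1p, q1m, q2p, q2m, q3p, q3m⟩ := hC
  linarith [mul_nonneg n1m r2m, mul_nonneg t2p q2m, mul_nonneg n0p m1,
        mul_nonneg q2m e1, mul_nonneg t0p q2m, mul_nonneg n0p m3, mul_nonneg q2p o,
        mul_nonneg n0p e1, mul_nonneg n1m o, mul_nonneg n0p e2, mul_nonneg n1p r1m,
        mul_nonneg n2m q2m, mul_nonneg n1m e3, mul_nonneg n1m e1, mul_nonneg n3p e3,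
        mul_nonneg r2p q3m, mul_nonneg n0m m1, mul_nonneg q1p e3, mul_nonneg r2m q3p,
        mul_nonneg n3p t0m, mul_nonneg n0m o, mul_nonneg n0m e0, mul_nonneg t0p q0m,
        mul_nonneg n3p q3m, mul_nonneg n1p t0p, mul_nonneg n0m e3, mul_nonneg r2m e2,
        mul_nonneg n0m q3p, mul_nonneg n0m e1, mul_nonneg n0p m2, mul_nonneg n1p r2m,
        mul_nonneg q0p e3, mul_nonneg n0m q3m]

lemma core_pmp (s0 s1 s2 s3 d0 d1 d2 d3 : ℝ)
    (hC : PairCone s0 s1 s2 s3 d0 d1 d2 d3)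
    (m1 : 0 ≤ -s0 + s1) (m2 : 0 ≤ -s0 + s2) (m3 : 0 ≤ -s0 + s3) (o : 0 ≤ -s1 + s2) (e0 : 0 ≤ d0) (e1 : 0 ≤ d1) (e2 : 0 ≤ -d2) (e3 : 0 ≤ d3) :
    2 * (d0 ^ 2 + d1 ^ 2 + d2 ^ 2 + d3 ^ 2) ≤
      (s0 + s1 + s2 + s3) ^ 2 - 2 * (s0 ^ 2 + s1 ^ 2 + s2 ^ 2 + s3 ^ 2) := by
  obtain ⟨n0p, n0m, n1p, n1m, n2p, n2m, n3p, n3m, r0p, t0p, r0m, t0m, r1p, t1p,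
    r1m, t1m, r2p, t2p, r2m, t2m, q0p, q0m, q1p, q1m, q2p, q2m, q3p, q3m⟩ := hC
  linarith [mul_nonneg q1p m1, mul_nonneg q1p q2m, mul_nonneg r1m q3p,
        mul_nonneg q2m e1, mul_nonneg n0m n2p, mul_nonneg q3m m3, mul_nonneg n0m r1m,
        mul_nonneg n0p o, mul_nonneg q2p o, mul_nonneg t2m e3, mul_nonneg n2m q2m,
        mul_nonneg q1m q3p, mul_nonneg n2p e2, mul_nonneg n0m m2, mul_nonneg n0p m1,
        mul_nonneg n0p t1m, mul_nonneg q3m e0, mul_nonneg q0p e0, mul_nonneg n1m q2p,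
        mul_nonneg t0m q0p, mul_nonneg n0m n1m, mul_nonneg n0m o, mul_nonneg n0m q2m,
        mul_nonneg q1m e3, mul_nonneg q2m q3m, mul_nonneg q3p m3, mul_nonneg n0m e0,
        mul_nonneg n0p q3p, mul_nonneg r2p q3m, mul_nonneg n1m q1m, mul_nonneg q3m e1,
        mul_nonneg n0p e1, mul_nonneg n0p e0]

lemma core_pmm (s0 s1 s2 s3 d0 d1 d2 d3 : ℝ)
    (hC : PairCone s0 s1 s2 s3 d0 d1 d2 d3)
    (m1 : 0 ≤ -s0 + s1) (m2 : 0 ≤ -s0 + s2) (m3 : 0 ≤ -s0 + s3) (o : 0 ≤ -s1 + s2) (e0 : 0 ≤ d0) (e1 : 0 ≤ d1) (e2 : 0 ≤ -d2) (e3 : 0 ≤ -d3) :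
    2 * (d0 ^ 2 + d1 ^ 2 + d2 ^ 2 + d3 ^ 2) ≤
      (s0 + s1 + s2 + s3) ^ 2 - 2 * (s0 ^ 2 + s1 ^ 2 + s2 ^ 2 + s3 ^ 2) := by
  obtain ⟨n0p, n0m, n1p, n1m, n2p, n2m, n3p, n3m, r0p, t0p, r0m, t0m, r1p, t1p,
    r1m, t1m, r2p, t2p, r2m, t2m, q0p, q0m, q1p, q1m, q2p, q2m, q3p, q3m⟩ := hC
  linarith [mul_nonneg n0m r2p, mul_nonneg q2m m2, mul_nonneg r1m q3p,
        mul_nonneg n3p q3p, mul_nonneg n0m e1, mul_nonneg n0m q2m, mul_nonneg n0p m1,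
        mul_nonneg n0p q2m, mul_nonneg n1p o, mul_nonneg n1m m3, mul_nonneg t0p q2m,
        mul_nonneg q2m q3m, mul_nonneg n2p e0, mul_nonneg t0p e2, mul_nonneg n0m e0,
        mul_nonneg t1p q1p, mul_nonneg n0m t1p, mul_nonneg t0p t2m, mul_nonneg n2p e3,
        mul_nonneg n0m m1, mul_nonneg t0p o, mul_nonneg n2p e2, mul_nonneg n1m e1,
        mul_nonneg n2m q2m]

lemma core_mpp (s0 s1 s2 s3 d0 d1 d2 d3 : ℝ)
    (hC : PairCone s0 s1 s2 s3 d0 d1 d2 d3)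
    (m1 : 0 ≤ -s0 + s1) (m2 : 0 ≤ -s0 + s2) (m3 : 0 ≤ -s0 + s3) (o : 0 ≤ -s1 + s2) (e0 : 0 ≤ d0) (e1 : 0 ≤ -d1) (e2 : 0 ≤ d2) (e3 : 0 ≤ d3) :
    2 * (d0 ^ 2 + d1 ^ 2 + d2 ^ 2 + d3 ^ 2) ≤
      (s0 + s1 + s2 + s3) ^ 2 - 2 * (s0 ^ 2 + s1 ^ 2 + s2 ^ 2 + s3 ^ 2) := by
  obtain ⟨n0p, n0m, n1p, n1m, n2p, n2m, n3p, n3m, r0p, t0p, r0m, t0m, r1p, t1p,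
    r1m, t1m, r2p, t2p, r2m, t2m, q0p, q0m, q1p, q1m, q2p, q2m, q3p, q3m⟩ := hC
  linarith [mul_nonneg n0m n1p, mul_nonneg t0m o, mul_nonneg n2m q2m,
        mul_nonneg n0m e0, mul_nonneg q2p e2, mul_nonneg n1p r2m, mul_nonneg n0m t0p,
        mul_nonneg t0m r1p, mul_nonneg n1p q2m, mul_nonneg n1p m3, mul_nonneg n0m n3p,
        mul_nonneg q3m o, mul_nonneg n0p m1, mul_nonneg n0m e1, mul_nonneg t0m e2,
        mul_nonneg n0p n0m, mul_nonneg r1p q3m, mul_nonneg n0p r2m, mul_nonneg n1p e1,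
        mul_nonneg n0p q3m, mul_nonneg n0m n2p, mul_nonneg t1m q1m, mul_nonneg n2m e2,
        mul_nonneg n1m q1m, mul_nonneg t0p r2m, mul_nonneg r2m q3p, mul_nonneg t0p m1,
        mul_nonneg t0p t1m, mul_nonneg t0m e3, mul_nonneg q2p o]

lemma core_mpm (s0 s1 s2 s3 d0 d1 d2 d3 : ℝ)
    (hC : PairCone s0 s1 s2 s3 d0 d1 d2 d3)
    (m1 : 0 ≤ -s0 + s1) (m2 : 0 ≤ -s0 + s2) (m3 : 0 ≤ -s0 + s3) (o : 0 ≤ -s1 + s2) (e0 : 0 ≤ d0) (e1 : 0 ≤ -d1) (e2 : 0 ≤ d2) (e3 : 0 ≤ -d3) :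
    2 * (d0 ^ 2 + d1 ^ 2 + d2 ^ 2 + d3 ^ 2) ≤
      (s0 + s1 + s2 + s3) ^ 2 - 2 * (s0 ^ 2 + s1 ^ 2 + s2 ^ 2 + s3 ^ 2) := by
  obtain ⟨n0p, n0m, n1p, n1m, n2p, n2m, n3p, n3m, r0p, t0p, r0m, t0m, r1p, t1p,
    r1m, t1m, r2p, t2p, r2m, t2m, q0p, q0m, q1p, q1m, q2p, q2m, q3p, q3m⟩ := hC
  linarith [mul_nonneg q3m m3, mul_nonneg t1p q1m, mul_nonneg n1p e1,
        mul_nonneg t0p q0m, mul_nonneg q0p e3, mul_nonneg q2p m2, mul_nonneg q2p e2,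
        mul_nonneg n0p n0m, mul_nonneg q2p m1, mul_nonneg n0m n1p, mul_nonneg n0m q3m,
        mul_nonneg n0m n2m, mul_nonneg n0p r2m, mul_nonneg n0p m1, mul_nonneg q3m e2,
        mul_nonneg r2m q3p, mul_nonneg n0m q2p, mul_nonneg n0m e0, mul_nonneg n1p q1p,
        mul_nonneg q1m e1, mul_nonneg q2m o]

lemma core_mmp (s0 s1 s2 s3 d0 d1 d2 d3 : ℝ)
    (hC : PairCone s0 s1 s2 s3 d0 d1 d2 d3)
    (m1 : 0 ≤ -s0 + s1) (m2 : 0 ≤ -s0 + s2) (m3 : 0 ≤ -s0 + s3) (o : 0 ≤ -s1 + s2) (e0 : 0 ≤ d0) (e1 : 0 ≤ -d1) (e2 : 0 ≤ -d2) (e3 : 0 ≤ d3) :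
    2 * (d0 ^ 2 + d1 ^ 2 + d2 ^ 2 + d3 ^ 2) ≤
      (s0 + s1 + s2 + s3) ^ 2 - 2 * (s0 ^ 2 + s1 ^ 2 + s2 ^ 2 + s3 ^ 2) := by
  obtain ⟨n0p, n0m, n1p, n1m, n2p, n2m, n3p, n3m, r0p, t0p, r0m, t0m, r1p, t1p,
    r1m, t1m, r2p, t2p, r2m, t2m, q0p, q0m, q1p, q1m, q2p, q2m, q3p, q3m⟩ := hC
  linarith [mul_nonneg t0m q0p, mul_nonneg n0p n0m, mul_nonneg r1m q3p,
        mul_nonneg n1m r1p, mul_nonneg q2p o, mul_nonneg n1p q2m, mul_nonneg n3m q2m,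
        mul_nonneg n0m e0, mul_nonneg n2p q2p, mul_nonneg n0m q2p, mul_nonneg n0p m1,
        mul_nonneg n1p e1, mul_nonneg n1m t0m, mul_nonneg n2p e3, mul_nonneg n1p o,
        mul_nonneg n0m e2, mul_nonneg q1m q3p, mul_nonneg r2p e2, mul_nonneg n0m e1,
        mul_nonneg n0m q2m, mul_nonneg q3p e2, mul_nonneg n0m m3, mul_nonneg n0p n1p,
        mul_nonneg q1m e3, mul_nonneg r1p q3m, mul_nonneg n0m m1, mul_nonneg n2p t0p,
        mul_nonneg r2p q3m, mul_nonneg t1m e3, mul_nonneg n1p t0m, mul_nonneg q2m o,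
        mul_nonneg n0p m3]

lemma core_mmm (s0 s1 s2 s3 d0 d1 d2 d3 : ℝ)
    (hC : PairCone s0 s1 s2 s3 d0 d1 d2 d3)
    (m1 : 0 ≤ -s0 + s1) (m2 : 0 ≤ -s0 + s2) (m3 : 0 ≤ -s0 + s3) (o : 0 ≤ -s1 + s2) (e0 : 0 ≤ d0) (e1 : 0 ≤ -d1) (e2 : 0 ≤ -d2) (e3 : 0 ≤ -d3) :
    2 * (d0 ^ 2 + d1 ^ 2 + d2 ^ 2 + d3 ^ 2) ≤
      (s0 + s1 + s2 + s3) ^ 2 - 2 * (s0 ^ 2 + s1 ^ 2 + s2 ^ 2 + s3 ^ 2) := by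
  obtain ⟨n0p, n0m, n1p, n1m, n2p, n2m, n3p, n3m, r0p, t0p, r0m, t0m, r1p, t1p,
    r1m, t1m, r2p, t2p, r2m, t2m, q0p, q0m, q1p, q1m, q2p, q2m, q3p, q3m⟩ := hC
  rcases le_total s2 s3 with h | h
  · have o2 : 0 ≤ -s2 + s3 := by linarith
    linarith [mul_nonneg q3p o2, mul_nonneg n1p e1, mul_nonneg n0m n3m,
        mul_nonneg n1m q3p, mul_nonneg n1p o2, mul_nonneg n2p q2p, mul_nonneg n0p n1p,
        mul_nonneg n0m m1, mul_nonneg t0p q3m, mul_nonneg q3p m2, mul_nonneg n0m t0m,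
        mul_nonneg n2p e2, mul_nonneg n0p n0m, mul_nonneg t1p q1m, mul_nonneg r2p q3m,
        mul_nonneg n0m e0, mul_nonneg t0p e3, mul_nonneg n0p q0p, mul_nonneg n0m n2p,
        mul_nonneg n0m n1p, mul_nonneg n1p q2m, mul_nonneg q2m o, mul_nonneg n1m o2]
  rcases le_total s1 s3 with h' | h'
  · have o2 : 0 ≤ -s1 + s3 := by linarith
    have o3 : 0 ≤ s2 - s3 := by linarith
    linarith [mul_nonneg n0p m1, mul_nonneg r1p o3, mul_nonneg q2m o,
        mul_nonneg n0m e0, mul_nonneg n0m q2p, mul_nonneg n0m m1, mul_nonneg q3p e2,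
        mul_nonneg r1p t1p, mul_nonneg t0p o3, mul_nonneg r2p q3m, mul_nonneg r2p q2p,
        mul_nonneg t0p e2, mul_nonneg t0p e3, mul_nonneg n1p e1, mul_nonneg n1p r2p,
        mul_nonneg t0p m2, mul_nonneg n0m q2m, mul_nonneg n0m t0p, mul_nonneg n0p r2p,
        mul_nonneg q0p e3]
  · have o2 : 0 ≤ s1 - s3 := by linarith
    linarith [mul_nonneg q2p e3, mul_nonneg q2p o2, mul_nonneg t0p q0m,
        mul_nonneg t0p q2m, mul_nonneg r1p q3m, mul_nonneg q1m o2, mul_nonneg n0m e0,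
        mul_nonneg n0p n1p, mul_nonneg n1p q2m, mul_nonneg r1p q2m, mul_nonneg n0m n1m,
        mul_nonneg n1p e1, mul_nonneg n0p n0m, mul_nonneg q3p m3, mul_nonneg q1p e3,
        mul_nonneg q2p o, mul_nonneg n0p o2, mul_nonneg n0m t0m, mul_nonneg n3p t0m,
        mul_nonneg n0m m2, mul_nonneg n0m n2p, mul_nonneg n0p o, mul_nonneg n3p q3p,
        mul_nonneg r1p q1p, mul_nonneg n0p q0p, mul_nonneg n0m q3m, mul_nonneg n2p r2p,
        mul_nonneg q3p e1, mul_nonneg q2m o, mul_nonneg q0p q2m, mul_nonneg n1p q2p,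
        mul_nonneg r2p e2]

lemma PairCone.neg {s0 s1 s2 s3 d0 d1 d2 d3 : ℝ} (h : PairCone s0 s1 s2 s3 d0 d1 d2 d3) :
    PairCone s0 s1 s2 s3 (-d0) (-d1) (-d2) (-d3) := by
  cases h
  constructor <;> linarith

lemma PairCone.swap12 {s0 s1 s2 s3 d0 d1 d2 d3 : ℝ} (h : PairCone s0 s1 s2 s3 d0 d1 d2 d3) :
    PairCone s0 s2 s1 s3 d0 d2 d1 d3 := by
  cases h
  constructor <;> linarith

lemma PairCone.swap01 {s0 s1 s2 s3 d0 d1 d2 d3 : ℝ} (h : PairCone s0 s1 s2 s3 d0 d1 d2 d3) :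
    PairCone s1 s0 s2 s3 d1 d0 d2 d3 := by
  cases h
  constructor <;> linarith

lemma core_pos (s0 s1 s2 s3 d0 d1 d2 d3 : ℝ)
    (hC : PairCone s0 s1 s2 s3 d0 d1 d2 d3)
    (m1 : 0 ≤ -s0 + s1) (m2 : 0 ≤ -s0 + s2) (m3 : 0 ≤ -s0 + s3) (o : 0 ≤ -s1 + s2)
    (e0 : 0 ≤ d0) :
    2 * (d0 ^ 2 + d1 ^ 2 + d2 ^ 2 + d3 ^ 2) ≤
      (s0 + s1 + s2 + s3) ^ 2 - 2 * (s0 ^ 2 + s1 ^ 2 + s2 ^ 2 + s3 ^ 2) := by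
  rcases le_total 0 d1 with h1 | h1 <;> rcases le_total 0 d2 with h2 | h2 <;>
    rcases le_total 0 d3 with h3 | h3
  · exact core_ppp s0 s1 s2 s3 d0 d1 d2 d3 hC m1 m2 m3 o e0 h1 h2 h3
  · exact core_ppm s0 s1 s2 s3 d0 d1 d2 d3 hC m1 m2 m3 o e0 h1 h2 (by linarith)
  · exact core_pmp s0 s1 s2 s3 d0 d1 d2 d3 hC m1 m2 m3 o e0 h1 (by linarith) h3
  · exact core_pmm s0 s1 s2 s3 d0 d1 d2 d3 hC m1 m2 m3 o e0 h1 (by linarith) (by linarith)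
  · exact core_mpp s0 s1 s2 s3 d0 d1 d2 d3 hC m1 m2 m3 o e0 (by linarith) h2 h3
  · exact core_mpm s0 s1 s2 s3 d0 d1 d2 d3 hC m1 m2 m3 o e0 (by linarith) h2 (by linarith)
  · exact core_mmp s0 s1 s2 s3 d0 d1 d2 d3 hC m1 m2 m3 o e0 (by linarith) (by linarith) h3
  · exact core_mmm s0 s1 s2 s3 d0 d1 d2 d3 hC m1 m2 m3 o e0 (by linarith) (by linarith) (by linarith)

lemma core_ord (s0 s1 s2 s3 d0 d1 d2 d3 : ℝ)
    (hC : PairCone s0 s1 s2 s3 d0 d1 d2 d3)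
    (m1 : 0 ≤ -s0 + s1) (m2 : 0 ≤ -s0 + s2) (m3 : 0 ≤ -s0 + s3) (o : 0 ≤ -s1 + s2) :
    2 * (d0 ^ 2 + d1 ^ 2 + d2 ^ 2 + d3 ^ 2) ≤
      (s0 + s1 + s2 + s3) ^ 2 - 2 * (s0 ^ 2 + s1 ^ 2 + s2 ^ 2 + s3 ^ 2) := by
  rcases le_total 0 d0 with h | h
  · exact core_pos _ _ _ _ _ _ _ _ hC m1 m2 m3 o h
  · have := core_pos _ _ _ _ _ _ _ _ hC.neg m1 m2 m3 o (by linarith)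
    linarith

lemma core_min0 (s0 s1 s2 s3 d0 d1 d2 d3 : ℝ)
    (hC : PairCone s0 s1 s2 s3 d0 d1 d2 d3)
    (m1 : 0 ≤ -s0 + s1) (m2 : 0 ≤ -s0 + s2) (m3 : 0 ≤ -s0 + s3) :
    2 * (d0 ^ 2 + d1 ^ 2 + d2 ^ 2 + d3 ^ 2) ≤
      (s0 + s1 + s2 + s3) ^ 2 - 2 * (s0 ^ 2 + s1 ^ 2 + s2 ^ 2 + s3 ^ 2) := by
  rcases le_total s1 s2 with h | h
  · exact core_ord _ _ _ _ _ _ _ _ hC m1 m2 m3 (by linarith)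
  · have := core_ord _ _ _ _ _ _ _ _ hC.swap12 m2 m1 m3 (by linarith)
    linarith

lemma core_01 (s0 s1 s2 s3 d0 d1 d2 d3 : ℝ)
    (hC : PairCone s0 s1 s2 s3 d0 d1 d2 d3)
    (h2 : s0 ≤ s2) (h3 : s1 ≤ s2) :
    2 * (d0 ^ 2 + d1 ^ 2 + d2 ^ 2 + d3 ^ 2) ≤
      (s0 + s1 + s2 + s3) ^ 2 - 2 * (s0 ^ 2 + s1 ^ 2 + s2 ^ 2 + s3 ^ 2) := by
  rcases le_total s0 s1 with h | h
  · rcases le_total s0 s3 with h' | h'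
    · exact core_min0 _ _ _ _ _ _ _ _ hC (by linarith) (by linarith) (by linarith)
    · exact core_min3 _ _ _ _ _ _ _ _ hC (by linarith) (by linarith) (by linarith)
  · rcases le_total s1 s3 with h' | h'
    · have := core_min0 _ _ _ _ _ _ _ _ hC.swap01 (by linarith) (by linarith) (by linarith)
      linarith
    · exact core_min3 _ _ _ _ _ _ _ _ hC (by linarith) (by linarith) (by linarith)

lemma core (s0 s1 s2 s3 d0 d1 d2 d3 : ℝ)
    (hC : PairCone s0 s1 s2 s3 d0 d1 d2 d3) :
    2 * (d0 ^ 2 + d1 ^ 2 + d2 ^ 2 + d3 ^ 2) ≤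
      (s0 + s1 + s2 + s3) ^ 2 - 2 * (s0 ^ 2 + s1 ^ 2 + s2 ^ 2 + s3 ^ 2) := by
  rcases le_total s0 s2 with h2 | h2 <;> rcases le_total s1 s2 with h3 | h3
  · exact core_01 _ _ _ _ _ _ _ _ hC h2 h3
  · have := core_01 _ _ _ _ _ _ _ _ hC.swap12 (by linarith) (by linarith)
    linarith
  · have := core_01 _ _ _ _ _ _ _ _ hC.swap01.swap12 (by linarith) (by linarith)
    linarith
  · rcases le_total s0 s1 with h | h
    · have := core_01 _ _ _ _ _ _ _ _ hC.swap12 (by linarith) (by linarith)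
      linarith
    · have := core_01 _ _ _ _ _ _ _ _ hC.swap01.swap12 (by linarith) (by linarith)
      linarith

lemma code_card : Fintype.card {c : Fin 8 → ZMod 2 // H17.mulVec c = 0} = 16 := by
  decide +kernel

lemma code_dist : ∀ c : Fin 8 → ZMod 2, H17.mulVec c = 0 → c ≠ 0 → 4 ≤ hammingNorm c := by
  decide +kernel

lemma code_word : H17.mulVec ![1,1,1,1,0,0,0,0] = 0 ∧
    (![1,1,1,1,0,0,0,0] : Fin 8 → ZMod 2) ≠ 0 ∧
    hammingNorm (![1,1,1,1,0,0,0,0] : Fin 8 → ZMod 2) = 4 := by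
  decide +kernel

lemma code_parity : IsParityCheck H17 C17 := fun c => by
  simp [C17]

lemma code_finrank : Module.finrank (ZMod 2) C17 = 4 := by
  have h := Module.natCard_eq_pow_finrank (K := ZMod 2) (V := C17)
  have h2 : Nat.card C17 = 16 := by
    rw [← code_card, ← Nat.card_eq_fintype_card]
    exact Nat.card_congr (Equiv.subtypeEquivRight code_parity)
  rw [h2, Nat.card_zmod] at h
  exact (Nat.pow_right_injective (le_refl 2) (by simpa using h)).symm

lemma code_minDist : minDist C17 = 4 := by
  unfold minDist
  apply le_antisymm
  · exact Nat.sInf_le ⟨_, (code_parity _).2 code_word.1, code_word.2⟩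
  · apply le_csInf
    · exact ⟨4, _, (code_parity _).2 code_word.1, code_word.2⟩
    · rintro d ⟨c, hc, h0, rfl⟩
      exact code_dist c ((code_parity c).1 hc) h0

lemma supp0 : rowSupp H17 0 = {0, 3, 4, 7} := by decide +kernel
lemma supp1 : rowSupp H17 1 = {1, 3, 5, 7} := by decide +kernel
lemma supp2 : rowSupp H17 2 = {2, 3, 6, 7} := by decide +kernel
lemma supp3 : rowSupp H17 3 = {0, 1, 2, 3} := by decide +kernel
lemma supp4 : rowSupp H17 4 = {4, 5, 6, 7} := by decide +kernel

lemma four_cone {x : Fin 8 → ℝ} (hx : ∀ i, 0 ≤ x i) (a b c d : Fin 8)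
    (hab : a ≠ b) (hac : a ≠ c) (had : a ≠ d) (hbc : b ≠ c) (hbd : b ≠ d) (hcd : c ≠ d) :
    (∀ l ∈ ({a, b, c, d} : Finset (Fin 8)), x l ≤ ∑ i ∈ ({a, b, c, d} : Finset (Fin 8)).erase l, x i)
    ↔ (x a ≤ x b + x c + x d ∧ x b ≤ x a + x c + x d ∧ x c ≤ x a + x b + x d ∧
      x d ≤ x a + x b + x c) := by
  have key : ∀ l ∈ ({a, b, c, d} : Finset (Fin 8)),
      (x l ≤ ∑ i ∈ ({a, b, c, d} : Finset (Fin 8)).erase l, x i ↔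
        2 * x l ≤ x a + x b + x c + x d) := by
    intro l hl
    have h1 := Finset.add_sum_erase _ x hl
    have h2 : ∑ i ∈ ({a, b, c, d} : Finset (Fin 8)), x i = x a + x b + x c + x d := by
      rw [Finset.sum_insert, Finset.sum_insert, Finset.sum_insert, Finset.sum_singleton]
      · ring
      all_goals simp [*]
    constructor <;> intro h <;> linarith
  constructor
  · intro h
    have h' : ∀ l ∈ ({a, b, c, d} : Finset (Fin 8)), 2 * x l ≤ x a + x b + x c + x d :=
      fun l hl => (key l hl).1 (h l hl)
    have ha := h' a (by simp)
    have hb := h' b (by simp)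
    have hc := h' c (by simp)
    have hd := h' d (by simp)
    refine ⟨?_, ?_, ?_, ?_⟩ <;> linarith
  · rintro ⟨h1, h2, h3, h4⟩ l hl
    rw [key l hl]
    simp only [Finset.mem_insert, Finset.mem_singleton] at hl
    rcases hl with rfl | rfl | rfl | rfl <;> linarith

lemma cone_ineq {x : Fin 8 → ℝ} (hx : x ∈ fundCone H17) :
    4 * ∑ i, x i ^ 2 ≤ (∑ i, x i) ^ 2 := by
  obtain ⟨hn, hr⟩ := hx
  have r0 := hr 0
  have r1 := hr 1
  have r2 := hr 2
  have r3 := hr 3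
  have r4 := hr 4
  rw [supp0, four_cone hn _ _ _ _ (by decide) (by decide) (by decide) (by decide) (by decide)
    (by decide)] at r0
  rw [supp1, four_cone hn _ _ _ _ (by decide) (by decide) (by decide) (by decide) (by decide)
    (by decide)] at r1
  rw [supp2, four_cone hn _ _ _ _ (by decide) (by decide) (by decide) (by decide) (by decide)
    (by decide)] at r2
  rw [supp3, four_cone hn _ _ _ _ (by decide) (by decide) (by decide) (by decide) (by decide)
    (by decide)] at r3
  rw [supp4, four_cone hn _ _ _ _ (by decide) (by decide) (by decide) (by decide) (by decide)
    (by decide)] at r4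
  obtain ⟨a0, b0, c0, d0⟩ := r0
  obtain ⟨a1, b1, c1, d1⟩ := r1
  obtain ⟨a2, b2, c2, d2⟩ := r2
  obtain ⟨a3, b3, c3, d3⟩ := r3
  obtain ⟨a4, b4, c4, d4⟩ := r4
  have p0 := hn 0
  have p1 := hn 1
  have p2 := hn 2
  have p3 := hn 3
  have p4 := hn 4
  have p5 := hn 5
  have p6 := hn 6
  have p7 := hn 7
  have := core (x 0 + x 4) (x 1 + x 5) (x 2 + x 6) (x 3 + x 7)
    (x 0 - x 4) (x 1 - x 5) (x 2 - x 6) (x 3 - x 7) (by constructor <;> linarith)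
  simp only [Fin.sum_univ_eight]
  linarith

lemma pos_sq {x : Fin 8 → ℝ} (hx : x ≠ 0) : 0 < ∑ i, x i ^ 2 := by
  obtain ⟨i, hi⟩ := Function.ne_iff.1 hx
  exact Finset.sum_pos' (fun i _ => sq_nonneg _) ⟨i, Finset.mem_univ _, by
    have : x i ≠ 0 := hi
    positivity⟩

lemma word_cone : (![1,1,1,1,0,0,0,0] : Fin 8 → ℝ) ∈ fundCone H17 := by
  have hn : ∀ i, 0 ≤ (![1,1,1,1,0,0,0,0] : Fin 8 → ℝ) i := by
    intro i
    fin_cases i <;> simp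
  refine ⟨hn, fun j => ?_⟩
  fin_cases j
  · change ∀ l ∈ rowSupp H17 0, _ ≤ ∑ i ∈ (rowSupp H17 0).erase l, _
    rw [supp0, four_cone hn _ _ _ _ (by decide) (by decide) (by decide) (by decide) (by decide)
      (by decide)]
    simp
  · change ∀ l ∈ rowSupp H17 1, _ ≤ ∑ i ∈ (rowSupp H17 1).erase l, _
    rw [supp1, four_cone hn _ _ _ _ (by decide) (by decide) (by decide) (by decide) (by decide)
      (by decide)]
    simp
  · change ∀ l ∈ rowSupp H17 2, _ ≤ ∑ i ∈ (rowSupp H17 2).erase l, _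
    rw [supp2, four_cone hn _ _ _ _ (by decide) (by decide) (by decide) (by decide) (by decide)
      (by decide)]
    simp
  · change ∀ l ∈ rowSupp H17 3, _ ≤ ∑ i ∈ (rowSupp H17 3).erase l, _
    rw [supp3, four_cone hn _ _ _ _ (by decide) (by decide) (by decide) (by decide) (by decide)
      (by decide)]
    simp
  · change ∀ l ∈ rowSupp H17 4, _ ≤ ∑ i ∈ (rowSupp H17 4).erase l, _
    rw [supp4, four_cone hn _ _ _ _ (by decide) (by decide) (by decide) (by decide) (by decide)
      (by decide)]
    simp

lemma minPW_eq_s17 : minPW wAWGNC H17 = ((4 : ℝ) : EReal) := by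
  unfold minPW
  apply le_antisymm
  · apply sInf_le
    refine ⟨![1,1,1,1,0,0,0,0], ⟨word_cone, ?_⟩, ?_⟩
    · intro h
      have := congrFun (Set.mem_singleton_iff.1 h) 0
      simp at this
    · simp only [wAWGNC, Fin.sum_univ_eight]
      norm_num
      simp
      norm_num
  · apply le_sInf
    rintro _ ⟨x, ⟨hx, h0⟩, rfl⟩
    have h : (4 : ℝ) ≤ wAWGNC x := by
      unfold wAWGNC
      rw [le_div_iff₀ (pos_sq (by simpa using h0))]
      exact cone_ineq hx
    exact EReal.coe_le_coe_iff.2 h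

/-- `C = ker H17` is a binary linear code of length 8, dimension 4 and minimum
distance 4 (the extended Hamming code), and `w_AWGNC^min(H17) = 4`; in particular
`ρ_AWGNC(C) ≤ 5`. -/
theorem statement17 :
    Module.finrank (ZMod 2) C17 = 4 ∧
    minDist C17 = 4 ∧
    IsParityCheck H17 C17 ∧
    minPW wAWGNC H17 = ((4 : ℝ) : EReal) ∧
    pcRedundancy wAWGNC C17 ≤ (5 : ℕ∞) := by
  refine ⟨code_finrank, code_minDist, code_parity, minPW_eq_s17, ?_⟩
  unfold pcRedundancy
  apply sInf_le
  refine ⟨5, H17, by norm_num, code_parity, ?_⟩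
  rw [minPW_eq_s17, code_minDist]
  norm_num
end
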